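/- Let Φ be a regular root system. Then there exists a constant κ_Φ > 0, depending only on Φ, with the following property: for every group G equipped with a strong Φ-grading {X_α}_{α∈Φ}, the union ⋃_{α∈Φ} X_α is a Kazhdan subset of G with Kazhdan constant κ(G, ⋃X_α) ≥ κ_Φ; that is, for every unitary representation V of G with no nonzero G-invariant vectors and every unit vector v ∈ V there exist α ∈ Φ and x ∈ X_α with ‖xv − v‖ ≥ κ_Φ. -/

import Mathlib

section RootSystemDefs

variable {E : Type*} [AddCommGroup E] [Module ℝ E]

/-- A root system in a real vector space `E`: a finite subset that spans `E`,
does not contain `0`, and is closed under negation. -/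
structure IsRootSystem (Φ : Set E) : Prop where
  finite : Φ.Finite
  spans : Submodule.span ℝ Φ = ⊤
  zero_notMem : (0 : E) ∉ Φ
  neg_mem : ∀ α ∈ Φ, -α ∈ Φ

/-- `f ∈ F(Φ)`: a linear functional not vanishing on any root and taking
distinct values on distinct roots. -/
def IsRegularFunc (Φ : Set E) (f : E →ₗ[ℝ] ℝ) : Prop :=
  (∀ α ∈ Φ, f α ≠ 0) ∧ ∀ α ∈ Φ, ∀ β ∈ Φ, α ≠ β → f α ≠ f β

/-- The Borel set `Φ_f = {α ∈ Φ | f α > 0}`. -/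
def borelSet (Φ : Set E) (f : E →ₗ[ℝ] ℝ) : Set E :=
  {α ∈ Φ | 0 < f α}

/-- A Borel subset of `Φ`. -/
def IsBorelSet (Φ : Set E) (B : Set E) : Prop :=
  ∃ f : E →ₗ[ℝ] ℝ, IsRegularFunc Φ f ∧ B = borelSet Φ f

/-- Two Borel sets `B₁`, `B₂` are co-maximal if every Borel set containing
`B₁ ∩ B₂` equals `B₁` or `B₂`. -/
def CoMaximal (Φ : Set E) (B₁ B₂ : Set E) : Prop :=
  ∀ B : Set E, IsBorelSet Φ B → B₁ ∩ B₂ ⊆ B → B = B₁ ∨ B = B₂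

/-- The boundary of the Borel set `Φ_f`. -/
def borelBoundary (Φ : Set E) (f : E →ₗ[ℝ] ℝ) : Set E :=
  ⋃ B ∈ {B : Set E | IsBorelSet Φ B ∧ CoMaximal Φ (borelSet Φ f) B}, borelSet Φ f \ B

/-- The core of the Borel set `Φ_f`. -/
def borelCore (Φ : Set E) (f : E →ₗ[ℝ] ℝ) : Set E :=
  borelSet Φ f \ borelBoundary Φ f

/-- `Ψ` is a subsystem of `Φ` if `Ψ = Φ ∩ span ℝ Ψ`. -/
def IsSubsystem (Φ Ψ : Set E) : Prop :=
  Ψ = Φ ∩ (Submodule.span ℝ Ψ : Set E)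

/-- Irreducibility of a root system. -/
def IsIrreducibleRS (Φ : Set E) : Prop :=
  ¬ ∃ Φ₁ Φ₂ : Set E, Φ₁.Nonempty ∧ Φ₂.Nonempty ∧ Φ₁ ∪ Φ₂ = Φ ∧ Disjoint Φ₁ Φ₂ ∧
      Submodule.span ℝ Φ₁ ⊓ Submodule.span ℝ Φ₂ = ⊥

/-- The rank of a subset of `E` (the dimension of its span). -/
noncomputable def rankOf (Ψ : Set E) : ℕ := Module.finrank ℝ (Submodule.span ℝ Ψ)

/-- Regularity of a root system: every root lies in an irreducible rank-2 subsystem. -/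
def IsRegularRS (Φ : Set E) : Prop :=
  ∀ α ∈ Φ, ∃ Ψ : Set E, IsSubsystem Φ Ψ ∧ IsIrreducibleRS Ψ ∧ rankOf Ψ = 2 ∧ α ∈ Ψ

end RootSystemDefs

section GradingDefs

variable {E : Type*} [AddCommGroup E] [Module ℝ E] {G : Type*} [Group G]

/-- The grading condition: for roots `α, β` with `α ∉ ℝ_{<0}·β`, the commutator
`[X_α, X_β]` lies in the subgroup generated by the root subgroups `X_γ` with
`γ = aα + bβ ∈ Φ`, `a, b ≥ 1`. -/
def GradingCond (Φ : Set E) (X : E → Subgroup G) : Prop :=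
  ∀ α ∈ Φ, ∀ β ∈ Φ, (¬ ∃ c : ℝ, c < 0 ∧ α = c • β) →
    ⁅X α, X β⁆ ≤ ⨆ γ ∈ {γ ∈ Φ | ∃ a b : ℝ, 1 ≤ a ∧ 1 ≤ b ∧ γ = a • α + b • β}, X γ

/-- `{X_α}` is a `Φ`-grading of `G`: the grading condition holds and the root
subgroups generate `G`. -/
def IsGrading (Φ : Set E) (X : E → Subgroup G) : Prop :=
  GradingCond Φ X ∧ (⨆ α ∈ Φ, X α) = ⊤

/-- The grading is strong: for every regular functional `f` and every `γ` in the
core `C_f`, the root subgroup `X_γ` is contained in the subgroup generated by the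
`X_β` with `β ∈ Φ_f`, `β ∉ ℝγ`. -/
def IsStrong (Φ : Set E) (X : E → Subgroup G) : Prop :=
  ∀ f : E →ₗ[ℝ] ℝ, IsRegularFunc Φ f → ∀ γ ∈ borelCore Φ f,
    X γ ≤ ⨆ β ∈ {β ∈ borelSet Φ f | ¬ ∃ c : ℝ, β = c • γ}, X β

/-- The grading is `k`-strong: for every irreducible subsystem `Ψ` of rank `k`,
the family `{X_α}_{α ∈ Ψ}` is a strong `Ψ`-grading of the subgroup it generates. -/
def IsKStrong (Φ : Set E) (X : E → Subgroup G) (k : ℕ) : Prop :=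
  ∀ Ψ : Set E, IsSubsystem Φ Ψ → IsIrreducibleRS Ψ → rankOf Ψ = k →
    GradingCond Ψ X ∧ IsStrong Ψ X

end GradingDefs

section HilbertPart

variable {G : Type*} [Group G] {V : Type*} [NormedAddCommGroup V] [InnerProductSpace ℂ V]

/-- Vectors fixed by a subgroup. -/
def fixSub (ρ : G →* (V ≃ₗᵢ[ℂ] V)) (N : Subgroup G) : Submodule ℂ V where
  carrier := {v | ∀ g ∈ N, ρ g v = v}
  add_mem' := by
    intro a b ha hb g hg
    rw [map_add, ha g hg, hb g hg]
  zero_mem' := by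
    intro g _
    exact map_zero _
  smul_mem' := by
    intro c x hx g hg
    rw [map_smul, hx g hg]

lemma mem_fixSub {ρ : G →* (V ≃ₗᵢ[ℂ] V)} {N : Subgroup G} {v : V} :
    v ∈ fixSub ρ N ↔ ∀ g ∈ N, ρ g v = v := Iff.rfl

lemma fixSub_isClosed (ρ : G →* (V ≃ₗᵢ[ℂ] V)) (N : Subgroup G) :
    IsClosed (fixSub ρ N : Set V) := by
  have : (fixSub ρ N : Set V) = ⋂ g ∈ N, {v | ρ g v = v} := by
    ext v
    simp [mem_fixSub]
  rw [this]
  refine isClosed_biInter fun g _ => ?_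
  exact isClosed_eq (ρ g).continuous continuous_id

instance fixSub_proj [CompleteSpace V] (ρ : G →* (V ≃ₗᵢ[ℂ] V)) (N : Subgroup G) :
    (fixSub ρ N).HasOrthogonalProjection := by
  haveI : CompleteSpace (fixSub ρ N) := (fixSub_isClosed ρ N).completeSpace_coe
  infer_instance

variable [CompleteSpace V]

/-- The projection onto the vectors fixed by `N`. -/
noncomputable def pr (ρ : G →* (V ≃ₗᵢ[ℂ] V)) (N : Subgroup G) : V →L[ℂ] V :=
  (fixSub ρ N).starProjection

variable (ρ : G →* (V ≃ₗᵢ[ℂ] V))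

lemma rho_mul (g h : G) (v : V) : ρ (g * h) v = ρ g (ρ h v) := by
  rw [map_mul]; rfl

lemma rho_one (v : V) : ρ 1 v = v := by
  rw [map_one]; rfl

lemma rho_inv_self (g : G) (v : V) : ρ g⁻¹ (ρ g v) = v := by
  rw [← rho_mul, inv_mul_cancel, rho_one]

lemma rho_self_inv (g : G) (v : V) : ρ g (ρ g⁻¹ v) = v := by
  rw [← rho_mul, mul_inv_cancel, rho_one]

lemma rho_inner (g : G) (v w : V) : inner ℂ (ρ g v) w = inner ℂ v (ρ g⁻¹ w) := by
  conv_lhs => rw [← rho_self_inv ρ g w]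
  exact (ρ g).inner_map_map _ _

lemma pr_mem (N : Subgroup G) (v : V) : pr ρ N v ∈ fixSub ρ N :=
  Submodule.starProjection_apply_mem _ _

lemma pr_eq_self {N : Subgroup G} {v : V} (h : v ∈ fixSub ρ N) : pr ρ N v = v :=
  Submodule.starProjection_eq_self_iff.2 h

lemma pr_eq_self_iff {N : Subgroup G} {v : V} : pr ρ N v = v ↔ v ∈ fixSub ρ N :=
  Submodule.starProjection_eq_self_iff

lemma pr_inner_zero (N : Subgroup G) (v w : V) (hw : w ∈ fixSub ρ N) :
    inner ℂ (v - pr ρ N v) w = 0 :=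
  Submodule.starProjection_inner_eq_zero _ _ hw

lemma eq_pr {N : Subgroup G} {u v : V} (h1 : v ∈ fixSub ρ N)
    (h2 : ∀ w ∈ fixSub ρ N, inner ℂ (u - v) w = 0) : pr ρ N u = v :=
  Submodule.eq_starProjection_of_mem_of_inner_eq_zero h1 h2

lemma pr_symm (N : Subgroup G) (u v : V) : inner ℂ (pr ρ N u) v = inner ℂ u (pr ρ N v) :=
  Submodule.inner_starProjection_left_eq_right _ _ _

/-- Pythagoras. -/
lemma pr_pyth (N : Subgroup G) (v : V) : ‖v‖ ^ 2 = ‖pr ρ N v‖ ^ 2 + ‖v - pr ρ N v‖ ^ 2 := by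
  have h := Submodule.norm_sq_eq_add_norm_sq_starProjection v (fixSub ρ N)
  rw [Submodule.starProjection_orthogonal_val] at h
  exact h

lemma pr_norm_le (N : Subgroup G) (v : V) : ‖pr ρ N v‖ ≤ ‖v‖ :=
  Submodule.norm_starProjection_apply_le _ _

lemma fixSub_anti {M N : Subgroup G} (h : M ≤ N) : fixSub ρ N ≤ fixSub ρ M :=
  fun _ hv g hg => hv g (h hg)

lemma fixSub_sup {M N : Subgroup G} {v : V} (h1 : v ∈ fixSub ρ M) (h2 : v ∈ fixSub ρ N) :
    v ∈ fixSub ρ (M ⊔ N) := by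
  let S : Subgroup G :=
    { carrier := {g | ρ g v = v}
      mul_mem' := by
        intro a b ha hb
        simp only [Set.mem_setOf_eq] at *
        rw [rho_mul, hb, ha]
      one_mem' := rho_one ρ v
      inv_mem' := by
        intro a ha
        simp only [Set.mem_setOf_eq] at *
        conv_lhs => rw [← ha]
        exact rho_inv_self ρ a v }
  have : M ⊔ N ≤ S := sup_le h1 h2
  exact fun g hg => this hg

/-- Fixed vectors of a supremum of subgroups. -/
lemma mem_fixSub_of_le_biSup {ι : Type*} {s : Set ι} {X : ι → Subgroup G} {v : V} {K : Subgroup G}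
    (hK : K ≤ ⨆ i ∈ s, X i) (h : ∀ i ∈ s, ∀ g ∈ X i, ρ g v = v) : v ∈ fixSub ρ K := by
  let S : Subgroup G :=
    { carrier := {g | ρ g v = v}
      mul_mem' := by
        intro a b ha hb
        simp only [Set.mem_setOf_eq] at *
        rw [rho_mul, hb, ha]
      one_mem' := rho_one ρ v
      inv_mem' := by
        intro a ha
        simp only [Set.mem_setOf_eq] at *
        conv_lhs => rw [← ha]
        exact rho_inv_self ρ a v }
  have : K ≤ S := hK.trans (iSup₂_le h)
  exact fun g hg => this hg

lemma pr_pr_of_le {M N : Subgroup G} (h : M ≤ N) (v : V) : pr ρ N (pr ρ M v) = pr ρ N v := by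
  refine eq_pr ρ (pr_mem ρ N v) fun w hw => ?_
  have h1 := pr_inner_zero ρ N v w hw
  have h2 := pr_inner_zero ρ M v w (fixSub_anti ρ h hw)
  rw [inner_sub_left] at *
  rw [← h1, sub_left_inj]
  rw [sub_eq_zero] at h2
  exact h2.symm

lemma pr_pr_of_le' {M N : Subgroup G} (h : M ≤ N) (v : V) : pr ρ M (pr ρ N v) = pr ρ N v :=
  pr_eq_self ρ (fixSub_anti ρ h (pr_mem ρ N v))

/-- `K` normalizes `N` (elementwise version). -/
def Nrm (K N : Subgroup G) : Prop := ∀ g ∈ K, ∀ n ∈ N, g * n * g⁻¹ ∈ N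

lemma rho_mem_fixSub {N : Subgroup G} {g : G} (hg : ∀ n ∈ N, g⁻¹ * n * g ∈ N) {v : V}
    (hv : v ∈ fixSub ρ N) : ρ g v ∈ fixSub ρ N := by
  intro n hn
  have : n * g = g * (g⁻¹ * n * g) := by group
  rw [← rho_mul, this, rho_mul, hv _ (hg n hn)]

lemma Nrm.conj' {K N : Subgroup G} (h : Nrm K N) {g : G} (hg : g ∈ K) {n : G} (hn : n ∈ N) :
    g⁻¹ * n * g ∈ N := by
  have := h g⁻¹ (K.inv_mem hg) n hn
  rwa [inv_inv] at this

lemma pr_comm_rho {K N : Subgroup G} (h : Nrm K N) {g : G} (hg : g ∈ K) (v : V) :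
    pr ρ N (ρ g v) = ρ g (pr ρ N v) := by
  refine eq_pr ρ (rho_mem_fixSub ρ (fun n hn => h.conj' hg hn) (pr_mem ρ N v)) fun w hw => ?_
  rw [← map_sub, rho_inner]
  refine pr_inner_zero ρ N v _ (rho_mem_fixSub ρ (fun n hn => ?_) hw)
  rw [inv_inv]
  exact h g hg n hn

lemma pr_mem_fixSub {M N K : Subgroup G} (h : Nrm K N) (hM : M ≤ K) {v : V}
    (hv : v ∈ fixSub ρ M) : pr ρ N v ∈ fixSub ρ M := by
  intro g hg
  rw [← pr_comm_rho ρ h (hM hg), hv g hg]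

lemma pr_comm {M N K : Subgroup G} (h : Nrm K N) (hM : M ≤ K) (v : V) :
    pr ρ M (pr ρ N v) = pr ρ N (pr ρ M v) := by
  refine eq_pr ρ (pr_mem_fixSub ρ h hM (pr_mem ρ M v)) fun w hw => ?_
  rw [← map_sub, pr_symm]
  exact pr_inner_zero ρ M v _ (pr_mem_fixSub ρ h hM hw)

/-- An almost invariant vector is close to an invariant one. -/
lemma hull_lemma (N : Subgroup G) (v : V) (δ : ℝ)
    (h : ∀ g ∈ N, ‖ρ g v - v‖ ≤ δ) : ‖v - pr ρ N v‖ ≤ δ := by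
  letI : InnerProductSpace ℝ V := InnerProductSpace.rclikeToReal ℂ V
  let O : Set V := {x | ∃ g ∈ N, x = ρ g v}
  let K : Set V := closure (convexHull ℝ O)
  have hvO : v ∈ O := ⟨1, N.one_mem, (rho_one ρ v).symm⟩
  have hKne : K.Nonempty := ⟨v, subset_closure (subset_convexHull ℝ O hvO)⟩
  have hKc : Convex ℝ K := (convex_convexHull ℝ O).closure
  have hKcl : IsClosed K := isClosed_closure
  have hball : K ⊆ Metric.closedBall v δ := by
    refine closure_minimal (convexHull_min ?_ (convex_closedBall v δ)) Metric.isClosed_closedBall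
    rintro x ⟨g, hg, rfl⟩
    rw [Metric.mem_closedBall, dist_eq_norm]
    exact h g hg
  have hinv : ∀ g ∈ N, ∀ x ∈ K, ρ g x ∈ K := by
    intro g hg x hx
    have hO : O ⊆ (fun y => ρ g y) ⁻¹' K := by
      rintro y ⟨k, hk, rfl⟩
      refine subset_closure (subset_convexHull ℝ O ⟨g * k, N.mul_mem hg hk, ?_⟩)
      rw [rho_mul]
    have hconv : Convex ℝ ((fun y => ρ g y) ⁻¹' K) := by
      intro a ha b hb s t hs ht hst
      simp only [Set.mem_preimage] at *
      have := hKc ha hb hs ht hst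
      have e : ρ g (s • a + t • b) = s • ρ g a + t • ρ g b := by
        rw [map_add]
        congr 1
        · exact ((ρ g).toLinearEquiv.toLinearMap.restrictScalars ℝ).map_smul s a
        · exact ((ρ g).toLinearEquiv.toLinearMap.restrictScalars ℝ).map_smul t b
      rw [e]; exact this
    exact closure_minimal (convexHull_min hO hconv) (hKcl.preimage (ρ g).continuous) hx
  obtain ⟨c, hcK, hc⟩ := exists_norm_eq_iInf_of_complete_convex hKne hKcl.isComplete hKc 0
  have hmin := (norm_eq_iInf_iff_real_inner_le_zero hKc hcK).1 hc
  have hcfix : c ∈ fixSub ρ N := by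
    intro g hg
    have h1 := hmin (ρ g c) (hinv g hg c hcK)
    have hn : ‖ρ g c‖ = ‖c‖ := (ρ g).norm_map c
    have h2 : ‖ρ g c - c‖ ^ 2 ≤ 0 := by
      rw [zero_sub, inner_neg_left, inner_sub_right] at h1
      rw [@norm_sub_sq_real, hn, real_inner_comm]
      rw [real_inner_self_eq_norm_sq] at h1
      linarith
    have h3 : ‖ρ g c - c‖ = 0 := by nlinarith [norm_nonneg (ρ g c - c)]
    exact sub_eq_zero.1 (norm_eq_zero.1 h3)
  have h4 : ‖v - pr ρ N v‖ ≤ ‖v - c‖ := by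
    have e : v - pr ρ N v = (v - c) - pr ρ N (v - c) := by
      rw [map_sub, pr_eq_self ρ hcfix]; abel
    have := pr_pyth ρ N (v - c)
    rw [e]
    exact abs_le_of_sq_le_sq' (by nlinarith [sq_nonneg ‖pr ρ N (v - c)‖]) (norm_nonneg _) |>.2
  refine h4.trans ?_
  have := hball hcK
  rwa [Metric.mem_closedBall, dist_comm, dist_eq_norm] at this

lemma almost_of_close (N : Subgroup G) (v : V) (δ : ℝ) (h : ‖v - pr ρ N v‖ ≤ δ) :
    ∀ g ∈ N, ‖ρ g v - v‖ ≤ 2 * δ := by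
  intro g hg
  have e : ρ g v - v = ρ g (v - pr ρ N v) - (v - pr ρ N v) := by
    rw [map_sub, pr_mem ρ N v g hg]; abel
  rw [e]
  calc _ ≤ ‖ρ g (v - pr ρ N v)‖ + ‖v - pr ρ N v‖ := norm_sub_le _ _
    _ = 2 * ‖v - pr ρ N v‖ := by rw [(ρ g).norm_map]; ring
    _ ≤ _ := by linarith

/-- displacement is subadditive -/
lemma disp_mul (v : V) (g h : G) : ‖ρ (g * h) v - v‖ ≤ ‖ρ g v - v‖ + ‖ρ h v - v‖ := by
  have e : ρ (g * h) v - v = ρ g (ρ h v - v) + (ρ g v - v) := by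
    rw [map_sub, rho_mul]; abel
  rw [e]
  refine (norm_add_le _ _).trans ?_
  rw [(ρ g).norm_map]; linarith

lemma disp_inv (v : V) (g : G) : ‖ρ g⁻¹ v - v‖ = ‖ρ g v - v‖ := by
  have e : ρ g⁻¹ v - v = - ρ g⁻¹ (ρ g v - v) := by
    rw [map_sub, rho_inv_self]; abel
  rw [e, norm_neg, (ρ g⁻¹).norm_map]

lemma disp_one (v : V) : ‖ρ 1 v - v‖ = 0 := by
  rw [rho_one, sub_self, norm_zero]

end HilbertPart

section AvgPart

variable {G : Type*} [Group G] {V : Type*} [NormedAddCommGroup V] [InnerProductSpace ℂ V]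
  [CompleteSpace V] (ρ : G →* (V ≃ₗᵢ[ℂ] V))

lemma Nrm.of_normal (N : Subgroup G) (h : N.Normal) : Nrm (⊤ : Subgroup G) N :=
  fun g _ n hn => h.conj_mem n hn g

lemma pr_comm_normal (M N : Subgroup G) (hN : N.Normal) (v : V) :
    pr ρ M (pr ρ N v) = pr ρ N (pr ρ M v) :=
  pr_comm ρ (Nrm.of_normal N hN) le_top v

lemma pr_sup (M N : Subgroup G) (hN : N.Normal) (v : V) :
    pr ρ (M ⊔ N) v = pr ρ M (pr ρ N v) := by
  have h : pr ρ M (pr ρ N v) ∈ fixSub ρ (M ⊔ N) := by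
    refine fixSub_sup ρ (pr_mem ρ _ _) ?_
    rw [pr_comm_normal ρ M N hN]
    exact pr_mem ρ _ _
  have h1 := pr_pr_of_le ρ (le_sup_left : M ≤ M ⊔ N) (pr ρ N v)
  rw [pr_eq_self ρ h, pr_pr_of_le ρ (le_sup_right : N ≤ M ⊔ N)] at h1
  exact h1.symm

lemma pr_le_norm {M N : Subgroup G} (h : M ≤ N) (v : V) :
    ‖v - pr ρ M v‖ ^ 2 ≤ ‖v - pr ρ N v‖ ^ 2 := by
  have h1 := pr_pyth ρ M v
  have h2 := pr_pyth ρ N v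
  have h3 := pr_norm_le ρ N (pr ρ M v)
  rw [pr_pr_of_le ρ h] at h3
  have := pow_le_pow_left₀ (norm_nonneg _) h3 2
  linarith

lemma pr_split (M N : Subgroup G) (hM : M.Normal) (v : V) :
    ‖v - pr ρ N v‖ ^ 2 = ‖pr ρ M v - pr ρ N (pr ρ M v)‖ ^ 2
      + ‖(v - pr ρ M v) - pr ρ N (v - pr ρ M v)‖ ^ 2 := by
  rw [pr_pyth ρ M (v - pr ρ N v)]
  rw [map_sub (pr ρ M), map_sub (pr ρ N), pr_comm_normal ρ N M hM]
  congr 3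
  abel

lemma avg_fin (Y : Subgroup G) (N : G → Subgroup G) (hN : ∀ a, (N a).Normal)
    (h1 : ∀ a ∈ Y, ∀ b ∈ Y, N (a * b) ≤ N a ⊔ N b)
    (h2 : ∀ a ∈ Y, ∀ b ∈ Y, N b ≤ N a ⊔ N (a * b))
    (h3 : ∀ a ∈ Y, ∀ b ∈ Y, N a ≤ N (a * b) ⊔ N b) (F : Finset G) :
    (∀ a ∈ F, a ∈ Y) →
    ∃ L : List G, L ≠ [] ∧ (∀ l ∈ L, l ∈ Y ∧ N l ≤ N 1 ⊔ ⨆ a ∈ F, N a) ∧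
      ∀ b ∈ Y, ∀ w : V, ((L.length : ℝ) / 2) * ‖w - pr ρ (N 1 ⊔ ⨆ a ∈ F, N a) w‖ ^ 2
        ≤ (L.map fun l => ‖w - pr ρ (N (b * l)) w‖ ^ 2).sum := by
  classical
  induction F using Finset.induction_on with
  | empty =>
    intro _
    refine ⟨[1], by simp, ?_, ?_⟩
    · intro l hl
      rw [List.mem_singleton] at hl
      subst hl
      exact ⟨Y.one_mem, le_sup_left⟩
    · intro b hb w
      have hle : N 1 ≤ N b := by
        have := h2 b hb 1 Y.one_mem
        rwa [mul_one, sup_idem] at this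
      have := pr_le_norm ρ hle w
      simp only [Finset.notMem_empty, iSup_false, iSup_bot, sup_bot_eq, List.length_singleton,
        List.map_cons, List.map_nil, List.sum_cons, List.sum_nil, mul_one]
      have h0 := sq_nonneg ‖w - pr ρ (N 1) w‖
      push_cast
      linarith
  | insert a F haF ih =>
    intro hF
    obtain ⟨L, hL0, hL1, hL2⟩ := ih fun x hx => hF x (Finset.mem_insert_of_mem hx)
    have haY : a ∈ Y := hF a (Finset.mem_insert_self _ _)
    set M : Subgroup G := N 1 ⊔ ⨆ a ∈ F, N a with hM
    have hMn : M.Normal := by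
      haveI := hN
      rw [hM]
      haveI : (⨆ a ∈ F, N a).Normal := Subgroup.biSup_normal _ _ fun i _ => hN i
      infer_instance
    have hM' : N 1 ⊔ ⨆ x ∈ insert a F, N x = N a ⊔ M := by
      rw [hM, Finset.iSup_insert, sup_left_comm]
    rw [hM']
    refine ⟨L ++ L.map (a * ·), by simp [hL0], ?_, ?_⟩
    · intro l hl
      rw [List.mem_append, List.mem_map] at hl
      rcases hl with hl | ⟨k, hk, rfl⟩
      · exact ⟨(hL1 l hl).1, (hL1 l hl).2.trans le_sup_right⟩
      · exact ⟨Y.mul_mem haY (hL1 k hk).1, (h1 a haY k (hL1 k hk).1).trans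
          (sup_le_sup le_rfl (hL1 k hk).2)⟩
    · intro b hb w
      have hba : b * a ∈ Y := Y.mul_mem hb haY
      set w0 := pr ρ M w with hw0
      set w1 := w - w0 with hw1
      have hw0f : w0 ∈ fixSub ρ M := pr_mem ρ M w
      -- inequality for `w0`
      have key0 : ∀ c ∈ Y, ∀ l ∈ L, ‖w0 - pr ρ (N c) w0‖ ^ 2 ≤ ‖w0 - pr ρ (N (c * l)) w0‖ ^ 2 := by
        intro c hc l hl
        have hfix : pr ρ (N (c * l)) w0 ∈ fixSub ρ (N c) := by
          refine fixSub_anti ρ (h3 c hc l (hL1 l hl).1) (fixSub_sup ρ (pr_mem ρ _ _) ?_)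
          exact pr_mem_fixSub ρ (Nrm.of_normal _ (hN (c * l))) le_top
            (fixSub_anti ρ (hL1 l hl).2 hw0f)
        have e : pr ρ (N (c * l)) w0 = pr ρ (N (c * l)) (pr ρ (N c) w0) := by
          rw [pr_comm_normal ρ _ _ (hN c), pr_eq_self ρ hfix]
        have hle : ‖pr ρ (N (c * l)) w0‖ ≤ ‖pr ρ (N c) w0‖ := by
          rw [e]; exact pr_norm_le ρ _ _
        have p1 := pr_pyth ρ (N c) w0
        have p2 := pr_pyth ρ (N (c * l)) w0
        have := pow_le_pow_left₀ (norm_nonneg _) hle 2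
        linarith
      have key1 : ‖w0 - pr ρ (N a) w0‖ ^ 2 ≤
          ‖w0 - pr ρ (N b) w0‖ ^ 2 + ‖w0 - pr ρ (N (b * a)) w0‖ ^ 2 := by
        have hfix : pr ρ (N (b * a)) (pr ρ (N b) w0) ∈ fixSub ρ (N a) := by
          refine fixSub_anti ρ (h2 b hb a haY) (fixSub_sup ρ ?_ (pr_mem ρ _ _))
          exact pr_mem_fixSub ρ (Nrm.of_normal _ (hN (b * a))) le_top (pr_mem ρ _ _)
        have s1 := pr_split ρ (N b) (N a) (hN b) w0
        -- distances
        set x := pr ρ (N b) w0 with hx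
        have d1 : ‖w0 - pr ρ (N a) w0‖ ^ 2 ≤ ‖w0 - pr ρ (N (b * a)) x‖ ^ 2 := by
          have q := pr_pyth ρ (N a) (w0 - pr ρ (N (b * a)) x)
          rw [map_sub, pr_eq_self ρ hfix, sub_sub_sub_cancel_right] at q
          rw [q]
          nlinarith [sq_nonneg ‖pr ρ (N a) w0 - pr ρ (N (b * a)) x‖]
        have d2 : ‖w0 - pr ρ (N (b * a)) x‖ ^ 2 = ‖x - pr ρ (N (b * a)) x‖ ^ 2 + ‖w0 - x‖ ^ 2 := by
          have q := pr_pyth ρ (N b) (w0 - pr ρ (N (b * a)) x)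
          have hf : pr ρ (N (b * a)) x ∈ fixSub ρ (N b) :=
            pr_mem_fixSub ρ (Nrm.of_normal _ (hN (b * a))) le_top (pr_mem ρ _ _)
          rw [map_sub, pr_eq_self ρ hf, sub_sub_sub_cancel_right] at q
          exact q
        have d3 := pr_split ρ (N b) (N (b * a)) (hN b) w0
        rw [← hx] at d3
        have := sq_nonneg ‖w0 - x - pr ρ (N (b * a)) (w0 - x)‖
        linarith
      have i1 := hL2 b hb w1
      have i2 := hL2 (b * a) hba w1
      have hpw1 : pr ρ M w1 = 0 := by
        rw [hw1, map_sub, pr_eq_self ρ hw0f, hw0, sub_self]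
      rw [hpw1, sub_zero] at i1 i2
      have sp : ∀ c, ‖w - pr ρ (N c) w‖ ^ 2 =
          ‖w0 - pr ρ (N c) w0‖ ^ 2 + ‖w1 - pr ρ (N c) w1‖ ^ 2 := fun c => pr_split ρ M (N c) hMn w
      have tot : ‖w - pr ρ (N a ⊔ M) w‖ ^ 2 = ‖w1‖ ^ 2 + ‖w0 - pr ρ (N a) w0‖ ^ 2 := by
        rw [pr_sup ρ _ _ hMn, ← hw0]
        have q := pr_pyth ρ M (w - pr ρ (N a) w0)
        have hf : pr ρ (N a) w0 ∈ fixSub ρ M :=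
          pr_mem_fixSub ρ (Nrm.of_normal _ (hN a)) le_top hw0f
        rw [map_sub, pr_eq_self ρ hf, sub_sub_sub_cancel_right, ← hw0, ← hw1] at q
        linarith
      have sumle : ∀ c ∈ Y, (L.length : ℝ) * ‖w0 - pr ρ (N c) w0‖ ^ 2 ≤
          (L.map fun l => ‖w0 - pr ρ (N (c * l)) w0‖ ^ 2).sum := by
        intro c hc
        have := List.card_nsmul_le_sum (L.map fun l => ‖w0 - pr ρ (N (c * l)) w0‖ ^ 2)
          (‖w0 - pr ρ (N c) w0‖ ^ 2) (by
            intro x hx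
            rw [List.mem_map] at hx
            obtain ⟨l, hl, rfl⟩ := hx
            exact key0 c hc l hl)
        rw [List.length_map, nsmul_eq_mul] at this
        exact this
      have j1 := sumle b hb
      have j2 := sumle (b * a) hba
      rw [List.map_append, List.sum_append, List.map_map, List.length_append, List.length_map, tot]
      have e2 : (List.map ((fun l => ‖w - pr ρ (N (b * l)) w‖ ^ 2) ∘ fun x => a * x) L).sum =
          (L.map fun l => ‖w - pr ρ (N (b * a * l)) w‖ ^ 2).sum := by
        simp only [Function.comp_def, mul_assoc]
      rw [e2]
      simp only [sp, List.sum_map_add]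
      push_cast
      have hLn : (0 : ℝ) ≤ L.length := Nat.cast_nonneg _
      have := mul_le_mul_of_nonneg_left key1 hLn
      linarith

lemma avg_lemma (Y : Subgroup G) (N : G → Subgroup G) (hN : ∀ a, (N a).Normal)
    (h1 : ∀ a ∈ Y, ∀ b ∈ Y, N (a * b) ≤ N a ⊔ N b)
    (h2 : ∀ a ∈ Y, ∀ b ∈ Y, N b ≤ N a ⊔ N (a * b))
    (h3 : ∀ a ∈ Y, ∀ b ∈ Y, N a ≤ N (a * b) ⊔ N b) (v : V) (δ : ℝ)
    (hv : ∀ a ∈ Y, ∀ g ∈ N a, ‖ρ g v - v‖ ≤ δ) :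
    ∀ g ∈ ⨆ a ∈ Y, N a, ‖ρ g v - v‖ ≤ 4 * δ := by
  classical
  have hδ : 0 ≤ δ := (norm_nonneg _).trans (hv 1 Y.one_mem 1 (N 1).one_mem)
  intro g hg
  obtain ⟨F, hF, hgF⟩ : ∃ F : Finset G, (∀ a ∈ F, a ∈ Y) ∧ g ∈ ⨆ a ∈ F, N a := by
    let S : Subgroup G :=
      { carrier := {g | ∃ F : Finset G, (∀ a ∈ F, a ∈ Y) ∧ g ∈ ⨆ a ∈ F, N a}
        mul_mem' := by
          rintro x y ⟨F, hF, hx⟩ ⟨F', hF', hy⟩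
          refine ⟨F ∪ F', ?_, ?_⟩
          · intro a ha
            rcases Finset.mem_union.1 ha with h | h
            exacts [hF a h, hF' a h]
          · rw [Finset.iSup_union]
            exact Subgroup.mul_mem_sup hx hy
        one_mem' := ⟨∅, by simp, Subgroup.one_mem _⟩
        inv_mem' := by
          rintro x ⟨F, hF, hx⟩
          exact ⟨F, hF, Subgroup.inv_mem _ hx⟩ }
    have : (⨆ a ∈ Y, N a) ≤ S := by
      refine iSup₂_le fun a ha x hx => ⟨{a}, by simpa using ha, ?_⟩
      simpa using hx
    exact this hg
  obtain ⟨L, hL0, hL1, hL2⟩ := avg_fin ρ Y N hN h1 h2 h3 F hF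
  have := hL2 1 Y.one_mem v
  set M : Subgroup G := N 1 ⊔ ⨆ a ∈ F, N a
  have up : (L.map fun l => ‖v - pr ρ (N (1 * l)) v‖ ^ 2).sum ≤ (L.length : ℝ) * δ ^ 2 := by
    have := List.sum_le_card_nsmul (L.map fun l => ‖v - pr ρ (N (1 * l)) v‖ ^ 2) (δ ^ 2) (by
      intro x hx
      rw [List.mem_map] at hx
      obtain ⟨l, hl, rfl⟩ := hx
      rw [one_mul]
      exact pow_le_pow_left₀ (norm_nonneg _) (hull_lemma ρ _ v δ (hv l (hL1 l hl).1)) 2)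
    rwa [List.length_map, nsmul_eq_mul] at this
  have hLpos : (0 : ℝ) < L.length := by
    exact_mod_cast List.length_pos_iff.2 hL0
  have h5 : ‖v - pr ρ M v‖ ^ 2 ≤ (2 * δ) ^ 2 := by
    have h6 : (L.length : ℝ) * (‖v - pr ρ M v‖ ^ 2) ≤ L.length * (2 * δ ^ 2) := by linarith
    have := le_of_mul_le_mul_left h6 hLpos
    nlinarith [sq_nonneg δ]
  have h7 : ‖v - pr ρ M v‖ ≤ 2 * δ := abs_le_of_sq_le_sq' h5 (by linarith) |>.2
  have := almost_of_close ρ M v _ h7 g ((le_sup_right : _ ≤ M) hgF)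
  linarith

end AvgPart

section NilPart
open scoped commutatorElement

/-- The preimage of a homomorphic image. -/
def imgSub {G Q : Type*} [Group G] [Group Q] (π : G →* Q) (τ : G → Q) (A : Subgroup G)
    (hmul : ∀ a ∈ A, ∀ b ∈ A, τ (a * b) = τ a * τ b) : Subgroup G where
  carrier := {g | ∃ a ∈ A, π g = τ a}
  mul_mem' := by
    rintro x y ⟨a, ha, hx⟩ ⟨b, hb, hy⟩
    exact ⟨a * b, A.mul_mem ha hb, by rw [map_mul, hx, hy, hmul a ha b hb]⟩
  one_mem' := by
    refine ⟨1, A.one_mem, ?_⟩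
    have := hmul 1 A.one_mem 1 A.one_mem
    rw [mul_one] at this
    rw [map_one]
    exact (left_eq_mul.1 this).symm
  inv_mem' := by
    rintro x ⟨a, ha, hx⟩
    refine ⟨a⁻¹, A.inv_mem ha, ?_⟩
    have h1 := hmul 1 A.one_mem 1 A.one_mem
    rw [mul_one] at h1
    have h1' : τ 1 = 1 := left_eq_mul.1 h1
    have := hmul a ha a⁻¹ (A.inv_mem ha)
    rw [mul_inv_cancel, h1'] at this
    rw [map_inv, hx]
    exact inv_eq_of_mul_eq_one_right this.symm

lemma imgSub_normal {G Q : Type*} [Group G] [Group Q] (π : G →* Q) (τ : G → Q) (A : Subgroup G)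
    (hmul : ∀ a ∈ A, ∀ b ∈ A, τ (a * b) = τ a * τ b)
    (hc : ∀ a ∈ A, ∀ q, τ a * q = q * τ a) : (imgSub π τ A hmul).Normal := by
  refine ⟨?_⟩
  rintro n ⟨a, ha, hn⟩ g
  refine ⟨a, ha, ?_⟩
  rw [map_mul, map_mul, hn, ← hc a ha, map_inv, mul_inv_cancel_right]

variable {J : Type*} [Fintype J]

lemma prod_normal {G : Type*} [Group G] {V : Type*} [NormedAddCommGroup V] [InnerProductSpace ℂ V]
    [CompleteSpace V] (ρ : G →* (V ≃ₗᵢ[ℂ] V)) (v : V) (T : J → Subgroup G)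
    (hT : ∀ j, (T j).Normal) (δ : ℝ) (h : ∀ j, ∀ g ∈ T j, ‖ρ g v - v‖ ≤ δ) :
    ∀ g ∈ ⨆ j, T j, ‖ρ g v - v‖ ≤ Fintype.card J * δ := by
  classical
  have key : ∀ F : Finset J, ∀ g ∈ ⨆ j ∈ F, T j, ‖ρ g v - v‖ ≤ F.card * δ := by
    intro F
    induction F using Finset.induction_on with
    | empty =>
      intro g hg
      simp only [Finset.notMem_empty, iSup_false, iSup_bot, Subgroup.mem_bot] at hg
      subst hg
      simp [disp_one]
    | insert a F ha ih =>
      intro g hg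
      rw [Finset.iSup_insert] at hg
      have := hT a
      obtain ⟨x, hx, y, hy, rfl⟩ := Subgroup.mem_sup_of_normal_left.1 hg
      refine (disp_mul ρ v x y).trans ?_
      have h1 := h a x hx
      have h2 := ih y hy
      rw [Finset.card_insert_of_notMem ha]
      push_cast
      linarith
  intro g hg
  have := key Finset.univ g (by simpa using hg)
  simpa using this

/-- Iterated commutators of generators. -/
def itComm {G : Type*} [Group G] (Y : J → Subgroup G) : ℕ → Set G
  | 0 => {g | ∃ j, g ∈ Y j}
  | k + 1 => {g | ∃ c ∈ itComm Y k, ∃ j, ∃ y ∈ Y j, g = ⁅c, y⁆}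

/-- The lower central series. -/
abbrev lcs (G : Type*) [Group G] (k : ℕ) : Subgroup G := (⊤ : Subgroup G).lowerCentralSeries k

lemma comm_mem_lcs {G : Type*} [Group G] {k : ℕ} {a : G} (ha : a ∈ lcs G k) (g : G) :
    ⁅a, g⁆ ∈ lcs G (k + 1) :=
  Subgroup.commutator_mem_commutator ha (Subgroup.mem_top g)

lemma comm_mem_lcs' {G : Type*} [Group G] {k : ℕ} {a : G} (ha : a ∈ lcs G k) (g : G) :
    ⁅g, a⁆ ∈ lcs G (k + 1) := by
  rw [← commutatorElement_inv]
  exact Subgroup.inv_mem _ (comm_mem_lcs ha g)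

/-- constants -/
def mlC (n : ℝ) : ℕ → ℝ
  | 0 => n
  | k + 1 => n * (4 * mlC n k)

lemma ml_lemma [Nonempty J] {G : Type*} [Group G] {V : Type*} [NormedAddCommGroup V]
    [InnerProductSpace ℂ V] [CompleteSpace V] (ρ : G →* (V ≃ₗᵢ[ℂ] V)) (v : V)
    (Y : J → Subgroup G) (hgen : ∀ S : Subgroup G, (∀ j, Y j ≤ S) → S = ⊤)
    {Q : Type*} [Group Q] (π : G →* Q) (hπ : Function.Surjective π) (δ : ℝ) (k : ℕ) :
    ∀ τ : G → Q, (∀ a ∈ lcs G k, ∀ b ∈ lcs G k, τ (a * b) = τ a * τ b) →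
      (∀ a ∈ lcs G k, ∀ q, τ a * q = q * τ a) →
      (∀ a ∈ lcs G (k + 1), τ a = 1) →
      (∀ c ∈ itComm Y k, ∀ g, π g = τ c → ‖ρ g v - v‖ ≤ δ) →
      ∀ a ∈ lcs G k, ∀ g, π g = τ a → ‖ρ g v - v‖ ≤ mlC (Fintype.card J) k * δ := by
  induction k with
  | zero =>
    intro τ hmul hc h1 hδ a _ g hg
    have hmul' : ∀ a b, τ (a * b) = τ a * τ b := fun a b =>
      hmul a (Subgroup.mem_top a) b (Subgroup.mem_top b)
    let T : J → Subgroup G := fun j => imgSub π τ (Y j) fun a _ b _ => hmul' a b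
    have hTn : ∀ j, (T j).Normal := fun j =>
      imgSub_normal π τ (Y j) _ fun a _ q => hc a (Subgroup.mem_top a) q
    have hT : ∀ j, ∀ g ∈ T j, ‖ρ g v - v‖ ≤ δ := by
      rintro j g ⟨y, hy, hg⟩
      exact hδ y ⟨j, hy⟩ g hg
    refine prod_normal ρ v T hTn δ hT g ?_
    -- membership
    let τh : G →* Q := MonoidHom.mk' τ hmul'
    have hS := hgen (((⨆ j, T j).map π).comap τh) (by
      intro j y hy
      obtain ⟨x, hx⟩ := hπ (τ y)
      exact ⟨x, (le_iSup T j) ⟨y, hy, hx⟩, hx⟩)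
    have hm : a ∈ ((⨆ j, T j).map π).comap τh := by rw [hS]; trivial
    obtain ⟨x, hx, hxa⟩ := hm
    have hxa' : π x = τ a := hxa
    obtain ⟨j⟩ := ‹Nonempty J›
    have hk : x⁻¹ * g ∈ T j := by
      refine ⟨1, (Y j).one_mem, ?_⟩
      rw [map_mul, map_inv, hxa', hg, inv_mul_cancel]
      exact (map_one τh).symm
    have := Subgroup.mul_mem _ hx ((le_iSup T j) hk)
    rwa [mul_inv_cancel_left] at this
  | succ k ih =>
    intro τ hmul hc h1 hδ a ha g hg
    have hconj : ∀ z ∈ lcs G (k + 1), ∀ x, τ (x * z * x⁻¹) = τ z := by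
      intro z hz x
      have e : x * z * x⁻¹ = ⁅x, z⁆ * z := by rw [commutatorElement_def]; group
      have h2 := comm_mem_lcs' hz x
      have h2' : ⁅x, z⁆ ∈ lcs G (k + 1) :=
        Subgroup.lowerCentralSeries_antitone _ (Nat.le_succ _) h2
      rw [e, hmul _ h2' _ hz, h1 _ h2, one_mul]
    have hleft : ∀ a ∈ lcs G k, ∀ b ∈ lcs G k, ∀ y,
        τ ⁅a * b, y⁆ = τ ⁅a, y⁆ * τ ⁅b, y⁆ := by
      intro a ha b hb y
      have e : ⁅a * b, y⁆ = (a * ⁅b, y⁆ * a⁻¹) * ⁅a, y⁆ := by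
        simp only [commutatorElement_def]; group
      have hby := comm_mem_lcs hb y
      have hay := comm_mem_lcs ha y
      have hcj : a * ⁅b, y⁆ * a⁻¹ ∈ lcs G (k + 1) :=
        (inferInstance : (lcs G (k + 1)).Normal).conj_mem _ hby a
      rw [e, hmul _ hcj _ hay, hconj _ hby, ← hc _ hay]
    have hright : ∀ a ∈ lcs G k, ∀ y z, τ ⁅a, y * z⁆ = τ ⁅a, y⁆ * τ ⁅a, z⁆ := by
      intro a ha y z
      have e : ⁅a, y * z⁆ = ⁅a, y⁆ * (y * ⁅a, z⁆ * y⁻¹) := by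
        simp only [commutatorElement_def]; group
      have haz := comm_mem_lcs ha z
      have hay := comm_mem_lcs ha y
      have hcj : y * ⁅a, z⁆ * y⁻¹ ∈ lcs G (k + 1) :=
        (inferInstance : (lcs G (k + 1)).Normal).conj_mem _ haz y
      rw [e, hmul _ hay _ hcj, hconj _ haz]
    have ih' : ∀ j, ∀ y ∈ Y j, ∀ a ∈ lcs G k, ∀ g, π g = τ ⁅a, y⁆ →
        ‖ρ g v - v‖ ≤ mlC (Fintype.card J) k * δ := by
      intro j y hy
      refine ih (fun a => τ ⁅a, y⁆) (fun a ha b hb => hleft a ha b hb y)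
        (fun a ha q => hc _ (comm_mem_lcs ha y) q) (fun a ha => h1 _ (comm_mem_lcs ha y)) ?_
      intro c hcc g hg
      exact hδ _ ⟨c, hcc, j, y, hy, rfl⟩ g hg
    let N : G → Subgroup G := fun y =>
      imgSub π (fun a => τ ⁅a, y⁆) (lcs G k) (fun a ha b hb => hleft a ha b hb y)
    have hN : ∀ y, (N y).Normal := fun y =>
      imgSub_normal π _ _ _ fun a ha q => hc _ (comm_mem_lcs ha y) q
    have r1 : ∀ y z, N (y * z) ≤ N y ⊔ N z := by
      rintro y z g ⟨a, ha, hg⟩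
      obtain ⟨x, hx⟩ := hπ (τ ⁅a, y⁆)
      have e : g = x * (x⁻¹ * g) := by group
      rw [e]
      refine Subgroup.mul_mem_sup ⟨a, ha, hx⟩ ⟨a, ha, ?_⟩
      simp only at hg
      rw [map_mul, map_inv, hx, hg, hright a ha, inv_mul_cancel_left]
    have r2 : ∀ y z, N z ≤ N y ⊔ N (y * z) := by
      rintro y z g ⟨a, ha, hg⟩
      obtain ⟨x, hx⟩ := hπ (τ ⁅a, y⁆)
      have e : g = x⁻¹ * (x * g) := by group
      rw [e]
      refine Subgroup.mul_mem_sup (Subgroup.inv_mem _ ⟨a, ha, hx⟩) ⟨a, ha, ?_⟩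
      simp only at hg ⊢
      rw [map_mul, hx, hg, hright a ha]
    have r3 : ∀ y z, N y ≤ N (y * z) ⊔ N z := by
      rintro y z g ⟨a, ha, hg⟩
      obtain ⟨x, hx⟩ := hπ (τ ⁅a, z⁆)
      have e : g = (g * x) * x⁻¹ := by group
      rw [e]
      refine Subgroup.mul_mem_sup ⟨a, ha, ?_⟩ (Subgroup.inv_mem _ ⟨a, ha, hx⟩)
      simp only at hg ⊢
      rw [map_mul, hx, hg, hright a ha]
    let S : J → Subgroup G := fun j => ⨆ y ∈ Y j, N y
    have hSn : ∀ j, (S j).Normal := fun j => Subgroup.biSup_normal (Y j : Set G) N fun i _ => hN i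
    have hS : ∀ j, ∀ g ∈ S j, ‖ρ g v - v‖ ≤ 4 * (mlC (Fintype.card J) k * δ) := by
      intro j
      refine avg_lemma ρ (Y j) N hN (fun a _ b _ => r1 a b) (fun a _ b _ => r2 a b)
        (fun a _ b _ => r3 a b) v _ ?_
      rintro y hy g ⟨a, ha, hg⟩
      exact ih' j y hy a ha g hg
    have hfin := prod_normal ρ v S hSn _ hS g
    have hτ1 : τ 1 = 1 := h1 1 (Subgroup.one_mem _)
    have hmem : g ∈ ⨆ j, S j := by
      have hin : ∀ p ∈ lcs G k, ∀ q, τ ⁅p, q⁆ ∈ (⨆ j, S j).map π := by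
        intro p hp q
        let τp : G →* Q := MonoidHom.mk' (fun q => τ ⁅p, q⁆) (hright p hp)
        have hS := hgen (((⨆ j, S j).map π).comap τp) (by
          intro j y hy
          obtain ⟨x, hx⟩ := hπ (τ ⁅p, y⁆)
          refine ⟨x, (le_iSup S j) ?_, hx⟩
          exact (le_iSup₂ (f := fun y (_ : y ∈ Y j) => N y) y hy) ⟨p, hp, hx⟩)
        have hm : q ∈ ((⨆ j, S j).map π).comap τp := by rw [hS]; trivial
        exact hm
      have hall : ∀ a ∈ lcs G (k + 1), τ a ∈ (⨆ j, S j).map π := by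
        intro a ha
        have ha' : a ∈ Subgroup.closure
            {x | ∃ p ∈ lcs G k, ∃ q ∈ (⊤ : Subgroup G), ⁅p, q⁆ = x} := ha
        refine Subgroup.closure_induction (p := fun x _ => τ x ∈ (⨆ j, S j).map π)
          ?_ ?_ ?_ ?_ ha'
        · rintro x ⟨p, hp, q, _, rfl⟩
          exact hin p hp q
        · rw [hτ1]; exact Subgroup.one_mem _
        · intro x y hx hy hx' hy'
          have hx2 : x ∈ lcs G (k + 1) := hx
          have hy2 : y ∈ lcs G (k + 1) := hy
          rw [hmul x hx2 y hy2]
          exact Subgroup.mul_mem _ hx' hy'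
        · intro x hx hx'
          have hx2 : x ∈ lcs G (k + 1) := hx
          have := hmul x hx2 x⁻¹ (Subgroup.inv_mem _ hx2)
          rw [mul_inv_cancel, hτ1] at this
          rw [← inv_eq_of_mul_eq_one_right this.symm]
          exact Subgroup.inv_mem _ hx'
      obtain ⟨x, hx, hxa⟩ := hall a ha
      obtain ⟨j⟩ := ‹Nonempty J›
      have hk : x⁻¹ * g ∈ S j := by
        refine (le_iSup₂ (f := fun y (_ : y ∈ Y j) => N y) 1 (Y j).one_mem) ?_
        refine ⟨1, Subgroup.one_mem _, ?_⟩
        simp only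
        rw [map_mul, map_inv, hxa, hg, inv_mul_cancel, commutatorElement_one_left, hτ1]
      have := Subgroup.mul_mem _ hx ((le_iSup S j) hk)
      rwa [mul_inv_cancel_left] at this
    have := hfin hmem
    rw [mlC]
    linarith

/-- displacement of iterated commutators -/
lemma itComm_disp {G : Type*} [Group G] {V : Type*} [NormedAddCommGroup V]
    [InnerProductSpace ℂ V] [CompleteSpace V] (ρ : G →* (V ≃ₗᵢ[ℂ] V)) (v : V)
    (Y : J → Subgroup G) (ε : ℝ) (hε : 0 ≤ ε) (hY : ∀ j, ∀ y ∈ Y j, ‖ρ y v - v‖ ≤ ε) (k : ℕ) :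
    ∀ c ∈ itComm Y k, ‖ρ c v - v‖ ≤ 4 ^ k * ε := by
  induction k with
  | zero =>
    rintro c ⟨j, hj⟩
    simpa using hY j c hj
  | succ k ih =>
    rintro _ ⟨c, hc, j, y, hy, rfl⟩
    have h1 := ih c hc
    have h2 := hY j y hy
    have h3 := disp_mul ρ v (c * y * c⁻¹) y⁻¹
    have h4 := disp_mul ρ v (c * y) c⁻¹
    have h5 := disp_mul ρ v c y
    rw [disp_inv] at h3 h4
    rw [commutatorElement_def]
    have h6 : ε ≤ 4 ^ k * ε := le_mul_of_one_le_left hε (one_le_pow₀ (by norm_num))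
    rw [pow_succ]
    linarith

lemma mlC_nonneg (n : ℝ) (hn : 0 ≤ n) (k : ℕ) : 0 ≤ mlC n k := by
  induction k with
  | zero => exact hn
  | succ k ih => rw [mlC]; positivity

theorem nil_aux (J : Type*) [Fintype J] [Nonempty J] (m : ℕ) : ∀ K : ℝ, 0 ≤ K → ∃ C : ℝ, 0 ≤ C ∧
    ∀ (G : Type*) [Group G] (V : Type*) [NormedAddCommGroup V]
    [InnerProductSpace ℂ V] [CompleteSpace V] (ρ : G →* (V ≃ₗᵢ[ℂ] V)) (v : V)
    (Y : J → Subgroup G), (∀ S : Subgroup G, (∀ j, Y j ≤ S) → S = ⊤) → ∀ ε : ℝ, 0 ≤ ε →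
    (∀ j, ∀ y ∈ Y j, ‖ρ y v - v‖ ≤ ε) →
    (∀ g ∈ lcs G m, ‖ρ g v - v‖ ≤ K * ε) →
    ∀ g, ‖ρ g v - v‖ ≤ C * ε := by
  induction m with
  | zero =>
    intro K hK
    refine ⟨K, hK, ?_⟩
    intro G _ V _ _ _ ρ v Y _ ε _ _ h g
    exact h g (Subgroup.mem_top g)
  | succ m ih =>
    intro K hK
    have hc := mlC_nonneg (Fintype.card J) (Nat.cast_nonneg _) m
    obtain ⟨C, hC, h⟩ := ih (mlC (Fintype.card J) m * (4 ^ m + K)) (by positivity)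
    refine ⟨C, hC, ?_⟩
    intro G _ V _ _ _ ρ v Y hgen ε hε hY hlow
    refine h G V ρ v Y hgen ε hε hY ?_
    intro g hg
    have hq : ∀ a ∈ lcs G (m + 1), (QuotientGroup.mk' (lcs G (m + 1))) a = 1 := fun a ha =>
      (QuotientGroup.eq_one_iff a).2 ha
    have := ml_lemma ρ v Y hgen (QuotientGroup.mk' (lcs G (m + 1)))
      (QuotientGroup.mk'_surjective _) ((4 ^ m + K) * ε) m
      (fun a => QuotientGroup.mk' (lcs G (m + 1)) a) (fun a _ b _ => map_mul _ a b) (by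
        intro a ha q
        obtain ⟨x, rfl⟩ := QuotientGroup.mk'_surjective _ q
        have h2 := hq _ (comm_mem_lcs ha x)
        rw [map_commutatorElement] at h2
        exact commutatorElement_eq_one_iff_mul_comm.1 h2) hq (by
        intro c hcc x hx
        have hk : c⁻¹ * x ∈ lcs G (m + 1) := by
          rw [← QuotientGroup.eq_one_iff]
          change QuotientGroup.mk' (lcs G (m + 1)) (c⁻¹ * x) = 1
          rw [map_mul, map_inv, hx, inv_mul_cancel]
        have h3 := disp_mul ρ v c (c⁻¹ * x)
        rw [mul_inv_cancel_left] at h3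
        have h4 := hlow _ hk
        have h5 := itComm_disp ρ v Y ε hε hY m c hcc
        linarith) g hg g rfl
    linarith

end NilPart

section GradedPart
open scoped commutatorElement
set_option linter.unusedSectionVars false

variable {E : Type*} [AddCommGroup E] [Module ℝ E] {G : Type*} [Group G]

/-- The subgroup generated by the root subgroups in `S`. -/
def gS (X : E → Subgroup G) (S : Set E) : Subgroup G := ⨆ β ∈ S, X β

lemma le_gS (X : E → Subgroup G) {S : Set E} {β : E} (h : β ∈ S) : X β ≤ gS X S :=
  le_biSup X h

lemma gS_le {X : E → Subgroup G} {S : Set E} {N : Subgroup G} (h : ∀ β ∈ S, X β ≤ N) :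
    gS X S ≤ N := iSup₂_le h

lemma gS_mono (X : E → Subgroup G) {S T : Set E} (h : S ⊆ T) : gS X S ≤ gS X T :=
  gS_le fun _ hβ => le_gS X (h hβ)

lemma gS_induction {X : E → Subgroup G} {S : Set E} {p : G → Prop}
    (hx : ∀ β ∈ S, ∀ x ∈ X β, p x) (h1 : p 1)
    (hmul : ∀ a b, a ∈ gS X S → b ∈ gS X S → p a → p b → p (a * b)) :
    ∀ g ∈ gS X S, p g := by
  intro g hg
  have hg' : g ∈ ⨆ β : S, X β := by
    rw [gS, iSup_subtype'] at hg
    exact hg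
  have : g ∈ gS X S ∧ p g := by
    refine Subgroup.iSup_induction (fun β : S => X β) (C := fun g => g ∈ gS X S ∧ p g) hg'
      ?_ ?_ ?_
    · exact fun i x h => ⟨le_gS X i.2 h, hx i i.2 x h⟩
    · exact ⟨Subgroup.one_mem _, h1⟩
    · exact fun x y hx hy => ⟨Subgroup.mul_mem _ hx.1 hy.1, hmul x y hx.1 hy.1 hx.2 hy.2⟩
  exact this.2

lemma comm_gS {X : E → Subgroup G} {S T : Set E} {N : Subgroup G}
    (hST : S ⊆ T) (hN : Nrm (gS X T) N)
    (h : ∀ α ∈ S, ∀ β ∈ T, ∀ x ∈ X α, ∀ y ∈ X β, ⁅x, y⁆ ∈ N) :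
    ⁅gS X S, gS X T⁆ ≤ N := by
  rw [Subgroup.commutator_le]
  refine gS_induction ?_ ?_ ?_
  · intro α hα x hx
    refine gS_induction (fun β hβ y hy => h α hα β hβ x hx y hy) ?_ ?_
    · rw [commutatorElement_one_right]; exact N.one_mem
    · intro a b ha _ h1 h2
      have : ⁅x, a * b⁆ = ⁅x, a⁆ * (a * ⁅x, b⁆ * a⁻¹) := by
        simp only [commutatorElement_def]; group
      rw [this]
      exact N.mul_mem h1 (hN a ha _ h2)
  · intro y _
    rw [commutatorElement_one_left]; exact N.one_mem
  · intro a b ha hb h1 h2 y hy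
    have : ⁅a * b, y⁆ = (a * ⁅b, y⁆ * a⁻¹) * ⁅a, y⁆ := by
      simp only [commutatorElement_def]; group
    rw [this]
    exact N.mul_mem (hN a (gS_mono X hST ha) _ (h2 y hy)) (h1 y hy)

/-- Ideals of a Borel set. -/
def IsIdl (Φ : Set E) (f : E →ₗ[ℝ] ℝ) (I : Set E) : Prop :=
  I ⊆ borelSet Φ f ∧ ∀ α ∈ I, ∀ β ∈ borelSet Φ f, ∀ γ ∈ Φ, ∀ a b : ℝ, 1 ≤ a → 1 ≤ b →
    γ = a • α + b • β → γ ∈ I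

lemma borel_not_neg {Φ : Set E} {f : E →ₗ[ℝ] ℝ} {α β : E} (hα : α ∈ borelSet Φ f)
    (hβ : β ∈ borelSet Φ f) : ¬ ∃ c : ℝ, c < 0 ∧ α = c • β := by
  rintro ⟨c, hc, rfl⟩
  have h1 := hα.2
  have h2 := hβ.2
  rw [map_smul, smul_eq_mul] at h1
  nlinarith

lemma comm_le_of_grading {Φ : Set E} {X : E → Subgroup G} (hX : GradingCond Φ X)
    {f : E →ₗ[ℝ] ℝ} {I : Set E} (α β : E) (hα : α ∈ borelSet Φ f) (hβ : β ∈ borelSet Φ f)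
    (h : ∀ γ ∈ Φ, ∀ a b : ℝ, 1 ≤ a → 1 ≤ b → γ = a • α + b • β → γ ∈ I) :
    ⁅X α, X β⁆ ≤ gS X I := by
  refine (hX α hα.1 β hβ.1 (borel_not_neg hα hβ)).trans (iSup₂_le ?_)
  rintro γ ⟨hγ, a, b, ha, hb, e⟩
  exact le_gS X (h γ hγ a b ha hb e)

lemma idl_nrm {Φ : Set E} {X : E → Subgroup G} (hX : GradingCond Φ X)
    {f : E →ₗ[ℝ] ℝ} {I : Set E} (hI : IsIdl Φ f I) : Nrm (gS X (borelSet Φ f)) (gS X I) := by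
  refine gS_induction ?_ ?_ ?_
  · intro β hβ x hx
    refine gS_induction ?_ ?_ ?_
    · intro α hα y hy
      have : x * y * x⁻¹ = ⁅x, y⁆ * y := by simp [commutatorElement_def]
      rw [this]
      refine Subgroup.mul_mem _ ?_ (le_gS X hα hy)
      refine comm_le_of_grading hX β α hβ (hI.1 hα) ?_ (Subgroup.commutator_mem_commutator hx hy)
      intro γ hγ a b ha hb e
      exact hI.2 α hα β hβ γ hγ b a hb ha (by rw [e, add_comm])
    · simp
    · intro a b _ _ h1 h2
      have : x * (a * b) * x⁻¹ = (x * a * x⁻¹) * (x * b * x⁻¹) := by group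
      rw [this]
      exact Subgroup.mul_mem _ h1 h2
  · intro n hn
    simpa using hn
  · intro a b _ _ h1 h2 n hn
    have : a * b * n * (a * b)⁻¹ = a * (b * n * b⁻¹) * a⁻¹ := by group
    rw [this]
    exact h1 _ (h2 n hn)

/-- Roots of height at least `n`. -/
def hgt (Φ : Set E) (f : E →ₗ[ℝ] ℝ) (n : ℕ) : Set E :=
  {α ∈ borelSet Φ f | n ≤ ({β ∈ borelSet Φ f | f β < f α}).ncard}

lemma hgt_succ {Φ : Set E} (hΦ : Φ.Finite) {f : E →ₗ[ℝ] ℝ} {n : ℕ} {α β γ : E}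
    (hα : α ∈ hgt Φ f n) (hβ : β ∈ borelSet Φ f) (hγ : γ ∈ Φ) {a b : ℝ} (ha : 1 ≤ a) (hb : 1 ≤ b)
    (e : γ = a • α + b • β) : γ ∈ hgt Φ f (n + 1) := by
  have h1 := hα.1.2
  have h2 := hβ.2
  have hlt : f α < f γ := by
    rw [e, map_add, map_smul, map_smul, smul_eq_mul, smul_eq_mul]; nlinarith
  refine ⟨⟨hγ, by linarith⟩, ?_⟩
  have hfin : ∀ c, ({β ∈ borelSet Φ f | f β < c}).Finite := fun c =>
    hΦ.subset fun x hx => hx.1.1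
  refine Nat.succ_le_of_lt (lt_of_le_of_lt hα.2 (Set.ncard_lt_ncard ?_ (hfin _)))
  refine ⟨fun x hx => ⟨hx.1, hx.2.trans hlt⟩, fun h => ?_⟩
  exact lt_irrefl _ (h ⟨hα.1, hlt⟩ : α ∈ {β ∈ borelSet Φ f | f β < f α}).2

lemma hgt_anti {Φ : Set E} {f : E →ₗ[ℝ] ℝ} {n : ℕ} : hgt Φ f (n + 1) ⊆ hgt Φ f n :=
  fun _ h => ⟨h.1, (Nat.le_succ n).trans h.2⟩

lemma hgt_idl {Φ : Set E} (hΦ : Φ.Finite) (f : E →ₗ[ℝ] ℝ) (n : ℕ) : IsIdl Φ f (hgt Φ f n) :=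
  ⟨fun _ h => h.1, fun _ hα _ hβ _ hγ _ _ ha hb e => hgt_anti (hgt_succ hΦ hα hβ hγ ha hb e)⟩

lemma hgt_empty {Φ : Set E} (hΦ : Φ.Finite) (f : E →ₗ[ℝ] ℝ) : hgt Φ f Φ.ncard = ∅ := by
  refine Set.eq_empty_iff_forall_notMem.2 fun α hα => ?_
  refine absurd hα.2 (not_le.2 (Set.ncard_lt_ncard ?_ hΦ))
  refine ⟨fun x hx => hx.1.1, fun h => lt_irrefl _ (h hα.1.1).2⟩

lemma lcs_le_hgt {Φ : Set E} (hΦ : Φ.Finite) {X : E → Subgroup G} (hX : GradingCond Φ X)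
    (f : E →ₗ[ℝ] ℝ) {S : Set E} (hS : S ⊆ borelSet Φ f) (n : ℕ) :
    (gS X S).lowerCentralSeries n ≤ gS X (hgt Φ f n) := by
  induction n with
  | zero => exact gS_mono X fun x hx => ⟨hS hx, Nat.zero_le _⟩
  | succ n ih =>
    rw [Subgroup.lowerCentralSeries_succ]
    refine (Subgroup.commutator_mono ih (gS_mono X hS)).trans ?_
    refine comm_gS (hgt_idl hΦ f n).1 (idl_nrm hX (hgt_idl hΦ f (n + 1))) ?_
    intro α hα β hβ x hx y hy
    refine comm_le_of_grading hX α β hα.1 hβ ?_ (Subgroup.commutator_mem_commutator hx hy)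
    intro γ hγ a b ha hb e
    exact hgt_succ hΦ hα hβ hγ ha hb e

universe u1 v1

/-- The constant for root nilpotent groups. -/
def IsNilC (Φ : Set E) (C : ℝ) : Prop :=
    ∀ (G : Type u1) [Group G] (X : E → Subgroup G), GradingCond Φ X →
    ∀ (V : Type v1) [NormedAddCommGroup V] [InnerProductSpace ℂ V] [CompleteSpace V]
    (ρ : G →* (V ≃ₗᵢ[ℂ] V)) (f : E →ₗ[ℝ] ℝ) (S : Set E), S ⊆ borelSet Φ f →
    ∀ (v : V) (ε : ℝ), 0 ≤ ε → (∀ β ∈ S, ∀ x ∈ X β, ‖ρ x v - v‖ ≤ ε) →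
    ∀ g ∈ gS X S, ‖ρ g v - v‖ ≤ C * ε

lemma exists_nilC {Φ : Set E} (hΦ : Φ.Finite) (hne : Φ.Nonempty) :
    ∃ C : ℝ, 0 ≤ C ∧ IsNilC.{u1, v1} Φ C := by
  classical
  haveI : Fintype Φ := hΦ.fintype
  haveI : Nonempty Φ := hne.to_subtype
  obtain ⟨C, hC, h⟩ := nil_aux.{_, u1, v1} Φ Φ.ncard 0 le_rfl
  refine ⟨C, hC, ?_⟩
  intro G _ X hX V _ _ _ ρ f S hS v ε hε hv g hg
  have := h (gS X S) V (ρ.comp (gS X S).subtype) v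
    (fun β => if (β : E) ∈ S then (X β).subgroupOf (gS X S) else ⊥) ?_ ε hε ?_ ?_ ⟨g, hg⟩
  · exact this
  · intro T hT
    have key : ∀ g ∈ gS X S, g ∈ T.map (gS X S).subtype := by
      refine gS_induction ?_ (Subgroup.one_mem _) (fun a b _ _ ha hb => Subgroup.mul_mem _ ha hb)
      intro β hβ x hx
      have h2 := hT ⟨β, (hS hβ).1⟩
      simp only [hβ, if_true] at h2
      exact ⟨⟨x, le_gS X hβ hx⟩, h2 (Subgroup.mem_subgroupOf.2 hx), rfl⟩
    refine eq_top_iff.2 fun g _ => ?_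
    obtain ⟨t, ht, e⟩ := key g g.2
    have : t = g := Subtype.ext e
    exact this ▸ ht
  · intro β y hy
    by_cases hβ : (β : E) ∈ S
    · simp only [hβ, if_true] at hy
      exact hv β hβ y (Subgroup.mem_subgroupOf.1 hy)
    · simp only [hβ, if_false, Subgroup.mem_bot] at hy
      subst hy
      rw [disp_one]; exact hε
  · intro g hg
    have h3 : lcs (gS X S) Φ.ncard = ⊥ := by
      rw [← (Subgroup.map_injective (gS X S).subtype_injective).eq_iff, Subgroup.map_bot,
        Subgroup.top_subtype_lowerCentralSeries, eq_bot_iff]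
      refine (lcs_le_hgt hΦ hX f hS _).trans ?_
      rw [hgt_empty hΦ]
      exact gS_le (by simp)
    rw [h3, Subgroup.mem_bot] at hg
    subst hg
    rw [disp_one]; simp

end GradedPart

section RootPart
set_option linter.unusedSectionVars false
open Filter Topology

variable {E : Type*} [AddCommGroup E] [Module ℝ E]

lemma sgn_pert (x y : ℝ) : ∀ᶠ t : ℝ in 𝓝[>] 0, (0 < x → 0 < x + t * y) ∧
    (x < 0 → x + t * y < 0) ∧ (x = 0 → 0 < y → 0 < x + t * y) ∧ (x = 0 → y < 0 → x + t * y < 0) := by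
  have hc : Tendsto (fun t : ℝ => x + t * y) (𝓝[>] 0) (𝓝 x) := by
    have : Continuous fun t : ℝ => x + t * y := by fun_prop
    have h := this.tendsto 0
    simp only [zero_mul, add_zero] at h
    exact h.mono_left nhdsWithin_le_nhds
  have ht : ∀ᶠ t : ℝ in 𝓝[>] 0, 0 < t := self_mem_nhdsWithin
  rcases lt_trichotomy x 0 with h | h | h
  · filter_upwards [hc.eventually (gt_mem_nhds h)] with t ht
    refine ⟨fun h' => by linarith, fun _ => ht, fun h' => by linarith, fun _ _ => ht⟩
  · filter_upwards [ht] with t ht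
    subst h
    refine ⟨fun h' => by linarith, fun h' => by linarith, fun _ hy => ?_, fun _ hy => ?_⟩
    · have := mul_pos ht hy; linarith
    · have := mul_neg_of_pos_of_neg ht hy; linarith
  · filter_upwards [hc.eventually (lt_mem_nhds h)] with t ht
    refine ⟨fun _ => ht, fun h' => by linarith, fun _ _ => ht, fun h' => by linarith⟩

lemma lex_pert {Φ : Set E} (hΦ : Φ.Finite) {θ : E →ₗ[ℝ] ℝ} (hθ : IsRegularFunc Φ θ)
    (h0 : E →ₗ[ℝ] ℝ) : ∃ h : E →ₗ[ℝ] ℝ, IsRegularFunc Φ h ∧ ∀ α ∈ Φ,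
      (0 < h0 α → 0 < h α) ∧ (h0 α < 0 → h α < 0) ∧ (h0 α = 0 → 0 < θ α → 0 < h α) ∧
      (h0 α = 0 → θ α < 0 → h α < 0) := by
  have e1 : ∀ᶠ t : ℝ in 𝓝[>] 0, ∀ α ∈ Φ, (0 < h0 α → 0 < h0 α + t * θ α) ∧
    (h0 α < 0 → h0 α + t * θ α < 0) ∧ (h0 α = 0 → 0 < θ α → 0 < h0 α + t * θ α) ∧
    (h0 α = 0 → θ α < 0 → h0 α + t * θ α < 0) :=
    (eventually_all_finite hΦ).2 fun α _ => sgn_pert _ _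
  have e2 : ∀ᶠ t : ℝ in 𝓝[>] 0, ∀ α ∈ Φ, ∀ β ∈ Φ, (0 < h0 (α - β) → 0 < h0 (α - β) + t * θ (α - β)) ∧
    (h0 (α - β) < 0 → h0 (α - β) + t * θ (α - β) < 0) ∧
    (h0 (α - β) = 0 → 0 < θ (α - β) → 0 < h0 (α - β) + t * θ (α - β)) ∧
    (h0 (α - β) = 0 → θ (α - β) < 0 → h0 (α - β) + t * θ (α - β) < 0) :=
    (eventually_all_finite hΦ).2 fun α _ => (eventually_all_finite hΦ).2 fun β _ => sgn_pert _ _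
  obtain ⟨t, h1, h2⟩ := (e1.and e2).exists
  have ap : ∀ x, (h0 + t • θ) x = h0 x + t * θ x := fun x => rfl
  refine ⟨h0 + t • θ, ⟨?_, ?_⟩, ?_⟩
  · intro α hα
    rw [ap]
    obtain ⟨a, b, c, d⟩ := h1 α hα
    rcases lt_trichotomy (h0 α) 0 with h | h | h
    · exact (b h).ne
    · rcases lt_or_gt_of_ne (hθ.1 α hα) with h' | h'
      · exact (d h h').ne
      · exact (c h h').ne'
    · exact (a h).ne'
  · intro α hα β hβ hne
    rw [← sub_ne_zero, ← map_sub, ap]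
    have hd : θ (α - β) ≠ 0 := by
      rw [map_sub, sub_ne_zero]; exact hθ.2 α hα β hβ hne
    obtain ⟨a, b, c, d⟩ := h2 α hα β hβ
    rcases lt_trichotomy (h0 (α - β)) 0 with h | h | h
    · exact (b h).ne
    · rcases lt_or_gt_of_ne hd with h' | h'
      · exact (d h h').ne
      · exact (c h h').ne'
    · exact (a h).ne'
  · intro α hα
    simp only [ap]
    exact h1 α hα

lemma exists_reg {Φ : Set E} (hΦ : IsRootSystem Φ) : ∃ θ : E →ₗ[ℝ] ℝ, IsRegularFunc Φ θ := by
  classical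
  haveI : Finite Φ := hΦ.finite
  let v : Φ ⊕ {p : Φ × Φ // p.1 ≠ p.2} → E := Sum.elim (fun α => α) (fun p => p.1.1 - p.1.2)
  obtain ⟨θ, hθ⟩ := Module.exists_dual_forall_apply_ne_zero (K := ℝ) v (by
    rintro (α | ⟨⟨α, β⟩, h⟩)
    · intro h
      exact hΦ.zero_notMem (h ▸ α.2)
    · intro h'
      exact h (Subtype.ext (sub_eq_zero.1 h')))
  refine ⟨θ, fun α hα => hθ (Sum.inl ⟨α, hα⟩), fun α hα β hβ hne => ?_⟩
  have := hθ (Sum.inr ⟨(⟨α, hα⟩, ⟨β, hβ⟩), fun h => hne (congrArg Subtype.val h)⟩)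
  rw [← sub_ne_zero, ← map_sub]
  exact this

lemma exists_sep {β δ : E} (h : ¬ ∃ c : ℝ, δ = c • β) :
    ∃ φ : E →ₗ[ℝ] ℝ, φ β = 0 ∧ φ δ = 1 := by
  have h1 : δ ∉ Submodule.span ℝ {β} := by
    rw [Submodule.mem_span_singleton]
    rintro ⟨c, e⟩
    exact h ⟨c, e.symm⟩
  obtain ⟨φ, h2, h3⟩ := Submodule.exists_le_ker_of_notMem h1
  refine ⟨(φ δ)⁻¹ • φ, ?_, ?_⟩
  · have : φ β = 0 := h3 (Submodule.mem_span_singleton_self β)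
    simp [this]
  · simp [inv_mul_cancel₀ h2]

lemma nonprop_symm {β δ : E} (hδ : δ ≠ 0) (h : ¬ ∃ c : ℝ, β = c • δ) :
    ¬ ∃ c : ℝ, δ = c • β := by
  rintro ⟨c, rfl⟩
  rcases eq_or_ne c 0 with hc | hc
  · exact hδ (by rw [hc, zero_smul])
  · exact h ⟨c⁻¹, by rw [smul_smul, inv_mul_cancel₀ hc, one_smul]⟩

lemma root_ne_zero {Φ : Set E} (hΦ : IsRootSystem Φ) {α : E} (hα : α ∈ Φ) : α ≠ 0 :=
  fun h => hΦ.zero_notMem (h ▸ hα)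

lemma exists_val {β δ : E} (hβ : β ≠ 0) (h : ¬ ∃ c : ℝ, δ = c • β) (p q : ℝ) :
    ∃ φ : E →ₗ[ℝ] ℝ, φ β = p ∧ φ δ = q := by
  obtain ⟨φ, h1, h2⟩ := exists_sep h
  obtain ⟨ψ, h3, h4⟩ := exists_sep (nonprop_symm hβ h)
  exact ⟨p • ψ + q • φ, by simp [h1, h4], by simp [h2, h3]⟩

lemma exists_reg_sgn {Φ : Set E} (hΦ : IsRootSystem Φ) {β δ : E} (hβ : β ∈ Φ) (hδ : δ ∈ Φ)
    (h : ¬ ∃ c : ℝ, δ = c • β) : (∃ θ : E →ₗ[ℝ] ℝ, IsRegularFunc Φ θ ∧ 0 < θ β ∧ θ δ < 0) ∧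
    (∃ θ : E →ₗ[ℝ] ℝ, IsRegularFunc Φ θ ∧ 0 < θ β ∧ 0 < θ δ) := by
  obtain ⟨θ, hθ⟩ := exists_reg hΦ
  constructor
  · obtain ⟨φ, h1, h2⟩ := exists_val (root_ne_zero hΦ hβ) h 1 (-1)
    obtain ⟨g, hg, hh⟩ := lex_pert hΦ.finite hθ φ
    exact ⟨g, hg, (hh β hβ).1 (by rw [h1]; norm_num), (hh δ hδ).2.1 (by rw [h2]; norm_num)⟩
  · obtain ⟨φ, h1, h2⟩ := exists_val (root_ne_zero hΦ hβ) h 1 1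
    obtain ⟨g, hg, hh⟩ := lex_pert hΦ.finite hθ φ
    exact ⟨g, hg, (hh β hβ).1 (by rw [h1]; norm_num), (hh δ hδ).1 (by rw [h2]; norm_num)⟩

lemma comax_prop {Φ : Set E} (hΦ : IsRootSystem Φ) {f g : E →ₗ[ℝ] ℝ} (hg : IsRegularFunc Φ g)
    (hfg : CoMaximal Φ (borelSet Φ f) (borelSet Φ g)) {β δ : E}
    (hβ : β ∈ borelSet Φ f \ borelSet Φ g) (hδ : δ ∈ borelSet Φ f \ borelSet Φ g) :
    ∃ c : ℝ, δ = c • β := by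
  by_contra hcon
  have neg : ∀ x, x ∈ borelSet Φ f \ borelSet Φ g → g x < 0 := fun x hx =>
    lt_of_le_of_ne (not_lt.1 fun h => hx.2 ⟨hx.1.1, h⟩) (hg.1 x hx.1.1)
  have gβ := neg β hβ
  have fβ := hβ.1.2
  set s : ℝ := f β / (- g β) with hs
  have spos : 0 < s := div_pos fβ (by linarith)
  let h0 : E →ₗ[ℝ] ℝ := f + s • g
  have ap : ∀ x, h0 x = f x + s * g x := fun x => rfl
  have z : h0 β = 0 := by
    have hne : g β ≠ 0 := gβ.ne
    rw [ap, hs, div_neg, neg_mul, div_mul_cancel₀ _ hne]; ring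
  have pos : ∀ x ∈ borelSet Φ f ∩ borelSet Φ g, 0 < h0 x := fun x hx => by
    rw [ap]; have := hx.1.2; have := mul_pos spos hx.2.2; linarith
  have fin : ∀ h, IsRegularFunc Φ h → (∀ x ∈ Φ, 0 < h0 x → 0 < h x) →
      (0 < h β ∨ 0 < h δ) → (h β < 0 ∨ h δ < 0) → False := by
    intro h hr hp h1 h2
    rcases hfg (borelSet Φ h) ⟨h, hr, rfl⟩ (fun x hx => ⟨hx.1.1, hp x hx.1.1 (pos x hx)⟩) with e | e
    · rcases h2 with h2 | h2
      · exact absurd (e ▸ hβ.1 : β ∈ borelSet Φ h).2 (not_lt.2 h2.le)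
      · exact absurd (e ▸ hδ.1 : δ ∈ borelSet Φ h).2 (not_lt.2 h2.le)
    · rcases h1 with h1 | h1
      · exact hβ.2 (e ▸ ⟨hβ.1.1, h1⟩)
      · exact hδ.2 (e ▸ ⟨hδ.1.1, h1⟩)
  rcases lt_or_ge 0 (h0 δ) with hd | hd
  · obtain ⟨θ, hθ, h1, h2⟩ := (exists_reg_sgn hΦ hδ.1.1 hβ.1.1
      (nonprop_symm (root_ne_zero hΦ hβ.1.1) hcon)).1
    obtain ⟨h, hr, hh⟩ := lex_pert hΦ.finite hθ h0
    exact fin h hr (fun x hx => (hh x hx).1) (Or.inr ((hh δ hδ.1.1).1 hd))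
      (Or.inl ((hh β hβ.1.1).2.2.2 z h2))
  · obtain ⟨θ, hθ, h1, h2⟩ := (exists_reg_sgn hΦ hβ.1.1 hδ.1.1 hcon).1
    obtain ⟨h, hr, hh⟩ := lex_pert hΦ.finite hθ h0
    refine fin h hr (fun x hx => (hh x hx).1) (Or.inl ((hh β hβ.1.1).2.2.1 z h1)) (Or.inr ?_)
    rcases hd.lt_or_eq with hd | hd
    · exact (hh δ hδ.1.1).2.1 hd
    · exact (hh δ hδ.1.1).2.2.2 hd h2

lemma mem_core_iff {Φ : Set E} {f : E →ₗ[ℝ] ℝ} {γ : E} : γ ∈ borelCore Φ f ↔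
    γ ∈ borelSet Φ f ∧ ∀ g, IsRegularFunc Φ g → CoMaximal Φ (borelSet Φ f) (borelSet Φ g) →
      γ ∈ borelSet Φ g := by
  constructor
  · rintro ⟨h1, h2⟩
    refine ⟨h1, fun g hg hc => by_contra fun hn => h2 ?_⟩
    exact Set.mem_biUnion (x := borelSet Φ g) ⟨⟨g, hg, rfl⟩, hc⟩ ⟨h1, hn⟩
  · rintro ⟨h1, h2⟩
    refine ⟨h1, fun h => ?_⟩
    obtain ⟨B, ⟨⟨g, hg, rfl⟩, hc⟩, h3⟩ := Set.mem_iUnion₂.1 h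
    exact h3.2 (h2 g hg hc)

lemma core_idl {Φ : Set E} (hΦ : IsRootSystem Φ) (f : E →ₗ[ℝ] ℝ) :
    IsIdl Φ f (borelCore Φ f) := by
  refine ⟨fun x hx => hx.1, ?_⟩
  intro α hα β hβ γ hγ a b ha hb e
  have hα' := mem_core_iff.1 hα
  have fα := hα'.1.2
  have fβ := hβ.2
  have γB : γ ∈ borelSet Φ f := by
    refine ⟨hγ, ?_⟩
    rw [e, map_add, map_smul, map_smul, smul_eq_mul, smul_eq_mul]; nlinarith
  refine mem_core_iff.2 ⟨γB, fun g hg hc => by_contra fun hn => ?_⟩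
  have gα := (hα'.2 g hg hc).2
  have gγ : ¬ 0 < g γ := fun h => hn ⟨hγ, h⟩
  have gβ : ¬ 0 < g β := fun h => gγ (by
    rw [e, map_add, map_smul, map_smul, smul_eq_mul, smul_eq_mul]; nlinarith)
  obtain ⟨c, hc⟩ := comax_prop hΦ hg hc (β := β) (δ := γ) ⟨hβ, fun h => gβ h.2⟩ ⟨γB, hn⟩
  have h1 : a • α = (c - b) • β := by rw [sub_smul, ← hc, e]; abel
  have h2 := congrArg f h1
  have h3 := congrArg g h1
  simp only [map_smul, smul_eq_mul] at h2 h3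
  have h4 : 0 < c - b := by
    by_contra h
    nlinarith
  have h5 : 0 < a * g α := by nlinarith
  have h6 : (c - b) * g β ≤ 0 := mul_nonpos_of_nonneg_of_nonpos h4.le (not_lt.1 gβ)
  linarith

lemma exists_core_aux {Φ : Set E} (hΦ : IsRootSystem Φ) {α β δ : E} (hα : α ∈ Φ) (hβ : β ∈ Φ)
    (hδ : δ ∈ Φ) (h1 : ¬ ∃ c : ℝ, β = c • α) (h2 : ¬ ∃ c : ℝ, δ = c • α) {b d : ℝ} (hb : 0 < b)
    (hd : 0 < d) (e : α = b • β + d • δ) : ∃ f, IsRegularFunc Φ f ∧ α ∈ borelCore Φ f := by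
  have h3 : ¬ ∃ c : ℝ, δ = c • β := by
    rintro ⟨c, rfl⟩
    exact nonprop_symm (root_ne_zero hΦ hα) h1 ⟨b + d * c, by rw [e, add_smul, mul_smul]⟩
  obtain ⟨f, hf, fβ, fδ⟩ := (exists_reg_sgn hΦ hβ hδ h3).2
  have fα : 0 < f α := by
    rw [e, map_add, map_smul, map_smul, smul_eq_mul, smul_eq_mul]; positivity
  refine ⟨f, hf, mem_core_iff.2 ⟨⟨hα, fα⟩, fun g hg hc => by_contra fun hn => ?_⟩⟩
  by_cases gβ : 0 < g β
  · by_cases gδ : 0 < g δ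
    · refine hn ⟨hα, ?_⟩
      rw [e, map_add, map_smul, map_smul, smul_eq_mul, smul_eq_mul]; positivity
    · exact h2 (comax_prop hΦ hg hc ⟨⟨hα, fα⟩, hn⟩ ⟨⟨hδ, fδ⟩, fun h => gδ h.2⟩)
  · exact h1 (comax_prop hΦ hg hc ⟨⟨hα, fα⟩, hn⟩ ⟨⟨hβ, fβ⟩, fun h => gβ h.2⟩)

lemma exists_core [FiniteDimensional ℝ E] {Φ : Set E} (hΦ : IsRootSystem Φ)
    (hreg : IsRegularRS Φ) {α : E} (hα : α ∈ Φ) :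
    ∃ f, IsRegularFunc Φ f ∧ α ∈ borelCore Φ f := by
  obtain ⟨Ψ, hsub, hirr, hrk, hαΨ⟩ := hreg α hα
  have hΨ : Ψ ⊆ Φ := fun x hx => (hsub ▸ hx : x ∈ Φ ∩ _).1
  obtain ⟨β, hβ, h1⟩ : ∃ β ∈ Ψ, ¬ ∃ c : ℝ, β = c • α := by
    by_contra! hcon
    have : Submodule.span ℝ Ψ ≤ Submodule.span ℝ {α} := Submodule.span_le.2 fun x hx => by
      obtain ⟨c, e⟩ := hcon x hx
      exact Submodule.mem_span_singleton.2 ⟨c, e.symm⟩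
    have h2 := Submodule.finrank_mono this
    have h3 := finrank_span_singleton (K := ℝ) (root_ne_zero hΦ hα)
    rw [rankOf] at hrk
    omega
  obtain ⟨δ, hδ, h2, h3⟩ : ∃ δ ∈ Ψ, (¬ ∃ c : ℝ, δ = c • α) ∧ (¬ ∃ c : ℝ, δ = c • β) := by
    by_contra! hcon
    refine hirr ⟨{x ∈ Ψ | ∃ c : ℝ, x = c • α}, {x ∈ Ψ | ¬ ∃ c : ℝ, x = c • α},
      ⟨α, hαΨ, 1, (one_smul _ _).symm⟩, ⟨β, hβ, h1⟩, ?_, ?_, ?_⟩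
    · ext x
      constructor
      · rintro (h | h) <;> exact h.1
      · intro h
        by_cases h' : ∃ c : ℝ, x = c • α
        · exact Or.inl ⟨h, h'⟩
        · exact Or.inr ⟨h, h'⟩
    · rw [Set.disjoint_left]
      exact fun x hx hy => hy.2 hx.2
    · have s1 : Submodule.span ℝ {x ∈ Ψ | ∃ c : ℝ, x = c • α} ≤ Submodule.span ℝ {α} :=
        Submodule.span_le.2 fun x ⟨_, c, e⟩ => Submodule.mem_span_singleton.2 ⟨c, e.symm⟩
      have s2 : Submodule.span ℝ {x ∈ Ψ | ¬ ∃ c : ℝ, x = c • α} ≤ Submodule.span ℝ {β} :=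
        Submodule.span_le.2 fun x ⟨hx, hx'⟩ => by
          obtain ⟨c, e⟩ := hcon x hx (by simpa using hx')
          exact Submodule.mem_span_singleton.2 ⟨c, e.symm⟩
      refine eq_bot_iff.2 fun x hx => ?_
      obtain ⟨a, ha⟩ := Submodule.mem_span_singleton.1 (s1 hx.1)
      obtain ⟨b, hb⟩ := Submodule.mem_span_singleton.1 (s2 hx.2)
      rcases eq_or_ne b 0 with hb0 | hb0
      · rw [Submodule.mem_bot, ← hb, hb0, zero_smul]
      · refine absurd ⟨b⁻¹ * a, ?_⟩ h1
        rw [mul_smul, ha, ← hb, smul_smul, inv_mul_cancel₀ hb0, one_smul]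
  have hli : LinearIndependent ℝ ![β, δ] := by
    rw [LinearIndependent.pair_iff' (root_ne_zero hΦ (hΨ hβ))]
    intro a e
    exact h3 ⟨a, e.symm⟩
  have hspan : Submodule.span ℝ {β, δ} = Submodule.span ℝ Ψ := by
    refine Submodule.eq_of_le_of_finrank_eq (Submodule.span_mono ?_) ?_
    · rintro x (rfl | rfl) <;> assumption
    · have := finrank_span_eq_card hli
      have hr : Set.range ![β, δ] = {β, δ} := by
        ext x
        simp [eq_comm, or_comm]
      rw [hr, Fintype.card_fin] at this
      rw [rankOf] at hrk
      rw [this, hrk]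
  have hmem : α ∈ Submodule.span ℝ {β, δ} := hspan ▸ Submodule.subset_span hαΨ
  obtain ⟨b, d, e⟩ := Submodule.mem_span_pair.1 hmem
  have hα0 := root_ne_zero hΦ hα
  have hb : b ≠ 0 := fun h => nonprop_symm hα0 h2 ⟨d, by rw [← e, h]; simp⟩
  have hd : d ≠ 0 := fun h => nonprop_symm hα0 h1 ⟨b, by rw [← e, h]; simp⟩
  have sg : ∀ (b : ℝ), b ≠ 0 → ∀ β ∈ Ψ, (¬ ∃ c : ℝ, β = c • α) →
      ∃ (b' : ℝ) (β' : E), 0 < b' ∧ β' ∈ Φ ∧ (¬ ∃ c : ℝ, β' = c • α) ∧ b • β = b' • β' := by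
    intro b hb β hβ h1
    rcases lt_or_gt_of_ne hb with h | h
    · refine ⟨-b, -β, by linarith, hΦ.neg_mem β (hΨ hβ), ?_, by simp⟩
      rintro ⟨c, e⟩
      exact h1 ⟨-c, by rw [neg_smul, ← e, neg_neg]⟩
    · exact ⟨b, β, h, hΨ hβ, h1, rfl⟩
  obtain ⟨b', β', hb', hβ', h1', e1⟩ := sg b hb β hβ h1
  obtain ⟨d', δ', hd', hδ', h2', e2⟩ := sg d hd δ hδ h2
  exact exists_core_aux hΦ hα hβ' hδ' h1' h2' hb' hd' (by rw [← e1, ← e2, e])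

lemma borel_finite {Φ : Set E} (hΦ : Φ.Finite) : {B | IsBorelSet Φ B}.Finite := by
  refine hΦ.finite_subsets.subset ?_
  rintro B ⟨f, _, rfl⟩
  exact fun x hx => hx.1

lemma borel_compl {Φ : Set E} {B : Set E} (hB : IsBorelSet Φ B) : IsBorelSet Φ (Φ \ B) := by
  obtain ⟨f, hf, rfl⟩ := hB
  refine ⟨-f, ⟨fun α hα => ?_, fun α hα β hβ hne => ?_⟩, ?_⟩
  · simpa using hf.1 α hα
  · simpa using hf.2 α hα β hβ hne
  · ext x
    constructor
    · rintro ⟨h1, h2⟩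
      refine ⟨h1, ?_⟩
      have h3 : ¬ 0 < f x := fun h => h2 ⟨h1, h⟩
      have := lt_of_le_of_ne (not_lt.1 h3) (hf.1 x h1)
      simpa using this
    · rintro ⟨h1, h2⟩
      refine ⟨h1, fun h => ?_⟩
      have h3 := h.2
      simp at h2
      linarith

lemma borel_card {Φ : Set E} [Fintype {B // IsBorelSet Φ B}] {γ : E} (hγ : γ ∈ Φ)
    [DecidablePred fun B : {B // IsBorelSet Φ B} => γ ∉ B.1] :
    2 * (Finset.univ.filter fun B : {B // IsBorelSet Φ B} => γ ∉ B.1).card =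
      Fintype.card {B // IsBorelSet Φ B} := by
  classical
  have h1 := Finset.card_filter_add_card_filter_not (s := (Finset.univ : Finset {B // IsBorelSet Φ B}))
    (fun B => γ ∉ B.1)
  have h2 : (Finset.univ.filter fun B : {B // IsBorelSet Φ B} => γ ∉ B.1).card =
      (Finset.univ.filter fun B : {B // IsBorelSet Φ B} => ¬ γ ∉ B.1).card := by
    have inv : ∀ B : {B // IsBorelSet Φ B}, Φ \ (Φ \ B.1) = B.1 := by
      rintro ⟨B, f, hf, rfl⟩
      exact Set.sdiff_sdiff_cancel_left fun x hx => hx.1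
    refine Finset.card_bij' (fun B _ => ⟨Φ \ B.1, borel_compl B.2⟩)
      (fun B _ => ⟨Φ \ B.1, borel_compl B.2⟩) ?_ ?_ ?_ ?_
    · intro B hB
      simp at hB ⊢
      exact ⟨hγ, hB⟩
    · intro B hB
      simp at hB ⊢
      exact fun _ => hB
    · intro B _
      exact Subtype.ext (inv B)
    · intro B _
      exact Subtype.ext (inv B)
  rw [Finset.card_univ] at h1
  omega

end RootPart

section VertexPart
set_option linter.unusedSectionVars false

universe u1 v1

lemma var_fin {ι V : Type*} [NormedAddCommGroup V] [InnerProductSpace ℂ V] (F : Finset ι)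
    (z : ι → V) (s : V) (hs : (F.card : ℝ) • s = ∑ i ∈ F, z i) :
    ∑ i ∈ F, ‖z i - s‖ ^ 2 = ∑ i ∈ F, ‖z i‖ ^ 2 - F.card * ‖s‖ ^ 2 := by
  have h1 : ∀ i ∈ F, ‖z i - s‖ ^ 2 = ‖z i‖ ^ 2 - 2 * RCLike.re (inner ℂ (z i) s) + ‖s‖ ^ 2 :=
    fun i _ => norm_sub_sq (𝕜 := ℂ) _ _
  rw [Finset.sum_congr rfl h1, Finset.sum_add_distrib, Finset.sum_sub_distrib, ← Finset.mul_sum,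
    ← map_sum, ← sum_inner, ← hs]
  have h2 : RCLike.re (inner ℂ ((F.card : ℝ) • s) s) = F.card * ‖s‖ ^ 2 := by
    rw [← Complex.coe_smul, inner_smul_left, Complex.conj_ofReal]
    rw [inner_self_eq_norm_sq_to_K]
    have : ((F.card : ℝ) : ℂ) * ((‖s‖ : ℝ) : ℂ) ^ 2 = ((F.card * ‖s‖ ^ 2 : ℝ) : ℂ) := by
      push_cast; ring
    exact congrArg Complex.re this
  rw [h2, Finset.sum_const, nsmul_eq_mul]
  ring

lemma cs_fin {ι V : Type*} [NormedAddCommGroup V] (F : Finset ι) (z : ι → V) :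
    ‖∑ i ∈ F, z i‖ ^ 2 ≤ F.card * ∑ i ∈ F, ‖z i‖ ^ 2 := by
  have h1 : ‖∑ i ∈ F, z i‖ ≤ ∑ i ∈ F, ‖z i‖ := norm_sum_le _ _
  refine (pow_le_pow_left₀ (norm_nonneg _) h1 2).trans ?_
  exact sq_sum_le_card_mul_sum_sq

lemma cs_improved {ι V : Type*} [NormedAddCommGroup V] [InnerProductSpace ℂ V] (F : Finset ι)
    (hF : F.Nonempty) (z : ι → V) (K : ℝ)
    (h : ∀ (s : V) (D : ℝ), 0 ≤ D → (F.card : ℝ) • s = ∑ i ∈ F, z i → (∀ i ∈ F, ‖z i - s‖ ≤ D) →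
      ‖s‖ ≤ K * D) :
    ‖∑ i ∈ F, z i‖ ^ 2 ≤ F.card * (∑ i ∈ F, ‖z i‖ ^ 2 -
      1 / (1 + F.card * K ^ 2) * ∑ i ∈ F, ‖z i‖ ^ 2) := by
  have hr : (0 : ℝ) < F.card := by exact_mod_cast hF.card_pos
  set r : ℝ := (F.card : ℝ) with hrdef
  set s : V := r⁻¹ • ∑ i ∈ F, z i with hs
  have e : r • s = ∑ i ∈ F, z i := by rw [hs, smul_smul, mul_inv_cancel₀ hr.ne', one_smul]
  have hv := var_fin F z s e
  set W := ∑ i ∈ F, ‖z i - s‖ ^ 2 with hW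
  have hW0 : 0 ≤ W := Finset.sum_nonneg fun i _ => sq_nonneg _
  have h1 := h s (Real.sqrt W) (Real.sqrt_nonneg _) e fun i hi => by
    refine Real.le_sqrt_of_sq_le ?_
    exact Finset.single_le_sum (f := fun i => ‖z i - s‖ ^ 2) (fun i _ => sq_nonneg _) hi
  have h2 : ‖s‖ ^ 2 ≤ K ^ 2 * W := by
    have := pow_le_pow_left₀ (norm_nonneg _) h1 2
    rwa [mul_pow, Real.sq_sqrt hW0] at this
  have h3 : ‖∑ i ∈ F, z i‖ ^ 2 = r ^ 2 * ‖s‖ ^ 2 := by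
    rw [← e, norm_smul, mul_pow, Real.norm_of_nonneg hr.le]
  rw [h3]
  set S := ∑ i ∈ F, ‖z i‖ ^ 2
  have hpos : 0 < 1 + r * K ^ 2 := by positivity
  have h4 : 1 / (1 + r * K ^ 2) * S ≤ W := by
    rw [one_div, inv_mul_le_iff₀ hpos]
    have : S = W + r * ‖s‖ ^ 2 := by linarith
    rw [this]
    nlinarith
  have h5 : S = W + r * ‖s‖ ^ 2 := by linarith
  nlinarith

variable {E : Type*} [AddCommGroup E] [Module ℝ E]

lemma min_exists {S : Set E} (hS : S.Finite) (hne : S.Nonempty) (f : E →ₗ[ℝ] ℝ) :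
    ∃ γ ∈ S, ∀ α ∈ S, f γ ≤ f α := Set.exists_min_image S f hS hne

lemma exists_remove {Φ : Set E} (hΦ : IsRootSystem Φ) {f : E →ₗ[ℝ] ℝ} {I : Set E}
    (hI : IsIdl Φ f I) (hne : I.Nonempty) : ∃ γ ∈ I, IsIdl Φ f (I \ {γ}) ∧
      (γ ∈ borelCore Φ f → I ⊆ borelCore Φ f) := by
  have hIf : I.Finite := hΦ.finite.subset fun x hx => (hI.1 hx).1
  have hlt : ∀ α ∈ borelSet Φ f, ∀ β ∈ borelSet Φ f, ∀ a b : ℝ, 1 ≤ a → 1 ≤ b →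
      f α < f (a • α + b • β) := by
    intro α hα β hβ a b ha hb
    have h1 := hα.2
    have h2 := hβ.2
    rw [map_add, map_smul, map_smul, smul_eq_mul, smul_eq_mul]; nlinarith
  by_cases h : (I \ borelCore Φ f).Nonempty
  · obtain ⟨γ, hγ, hmin⟩ := min_exists (hIf.subset Set.sdiff_subset) h f
    refine ⟨γ, hγ.1, ⟨fun x hx => hI.1 hx.1, ?_⟩, fun h' => absurd h' hγ.2⟩
    intro α hα β hβ γ' hγ' a b ha hb e
    refine ⟨hI.2 α hα.1 β hβ γ' hγ' a b ha hb e, ?_⟩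
    rintro rfl
    have hαC : α ∉ borelCore Φ f := fun hC => hγ.2 ((core_idl hΦ f).2 α hC β hβ γ' hγ' a b ha hb e)
    have h1 := hmin α ⟨hα.1, hαC⟩
    have h2 := hlt α (hI.1 hα.1) β hβ a b ha hb
    rw [← e] at h2
    linarith
  · obtain ⟨γ, hγ, hmin⟩ := min_exists hIf hne f
    refine ⟨γ, hγ, ⟨fun x hx => hI.1 hx.1, ?_⟩, fun _ x hx => by_contra fun hn => h ⟨x, hx, hn⟩⟩
    intro α hα β hβ γ' hγ' a b ha hb e
    refine ⟨hI.2 α hα.1 β hβ γ' hγ' a b ha hb e, ?_⟩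
    rintro rfl
    have h1 := hmin α hα.1
    have h2 := hlt α (hI.1 hα.1) β hβ a b ha hb
    rw [← e] at h2
    linarith

lemma exists_borel_sep {Φ : Set E} (hΦ : IsRootSystem Φ) {β γ : E} (hβ : β ∈ Φ) (hγ : γ ∈ Φ)
    (h : ¬ ∃ c : ℝ, β = c • γ) : ∃ B : {B // IsBorelSet Φ B}, β ∈ B.1 ∧ γ ∉ B.1 := by
  obtain ⟨θ, hθ, h1, h2⟩ := (exists_reg_sgn hΦ hβ hγ (nonprop_symm (root_ne_zero hΦ hγ) h)).1
  exact ⟨⟨borelSet Φ θ, θ, hθ, rfl⟩, ⟨hβ, h1⟩, fun h => absurd h.2 (not_lt.2 h2.le)⟩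

section
variable {G : Type u1} [Group G] {V : Type v1} [NormedAddCommGroup V] [InnerProductSpace ℂ V]
  [CompleteSpace V] (ρ : G →* (V ≃ₗᵢ[ℂ] V))

lemma pr_step {M N : Subgroup G} (h : M ≤ N) (v : V) :
    ‖v - pr ρ N v‖ ^ 2 = ‖v - pr ρ M v‖ ^ 2 + ‖pr ρ M v - pr ρ N v‖ ^ 2 := by
  rw [pr_pyth ρ M (v - pr ρ N v), map_sub, pr_pr_of_le' ρ h, add_comm]
  congr 3
  abel

theorem vertex_aux {Φ : Set E} (hΦ : IsRootSystem Φ) [Fintype {B // IsBorelSet Φ B}]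
    {CN : ℝ} (hCN : 0 ≤ CN) (hnil : IsNilC.{u1, v1} Φ CN) {X : E → Subgroup G}
    (hX : GradingCond Φ X) (hst : IsStrong Φ X) {f : E →ₗ[ℝ] ℝ} (hf : IsRegularFunc Φ f)
    (w : {B // IsBorelSet Φ B} → V)
    (hw : ∀ B', ∀ β ∈ borelSet Φ f, β ∈ B'.1 → ∀ x ∈ X β, ρ x (w B') = w B') (n : ℕ) :
    ∀ I : Set E, IsIdl Φ f I → I.ncard = n →
    ‖∑ B', w B' - pr ρ (gS X I) (∑ B', w B')‖ ^ 2 ≤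
      (Fintype.card {B // IsBorelSet Φ B} / 2 : ℝ) * (∑ B', ‖w B' - pr ρ (gS X I) (w B')‖ ^ 2 -
      1 / (1 + (Fintype.card {B // IsBorelSet Φ B} / 2 : ℝ) * (2 * CN) ^ 2) *
        ∑ B', ‖w B' - pr ρ (gS X (I ∩ borelCore Φ f)) (w B')‖ ^ 2) := by
  classical
  have hbot : gS X ∅ = ⊥ := eq_bot_iff.2 (gS_le (by simp))
  have pr_bot : ∀ v, pr ρ (gS X ∅) v = v := fun v => by
    refine pr_eq_self ρ fun g hg => ?_
    rw [hbot, Subgroup.mem_bot] at hg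
    rw [hg, rho_one]
  induction n with
  | zero =>
    intro I hI hc
    have hIf : I.Finite := hΦ.finite.subset fun x hx => (hI.1 hx).1
    rw [Set.ncard_eq_zero hIf] at hc
    subst hc
    simp [pr_bot, Set.empty_inter]
  | succ n ih =>
    intro I hI hc
    have hIf : I.Finite := hΦ.finite.subset fun x hx => (hI.1 hx).1
    have hne : I.Nonempty := by
      rw [← Set.ncard_pos hIf]; omega
    obtain ⟨γ, hγ, hI', hcore⟩ := exists_remove hΦ hI hne
    have ih' := ih _ hI' (by rw [Set.ncard_sdiff_singleton_of_mem hγ]; omega)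
    have hγB := hI.1 hγ
    set I' := I \ {γ} with hI'def
    have hle : gS X I' ≤ gS X I := gS_mono X Set.sdiff_subset
    have hnrm : Nrm (gS X (borelSet Φ f)) (gS X I) := idl_nrm hX hI
    have hnrm' : Nrm (gS X (borelSet Φ f)) (gS X I') := idl_nrm hX hI'
    have hXB : ∀ β ∈ borelSet Φ f, X β ≤ gS X (borelSet Φ f) := fun β hβ => le_gS X hβ
    have fixI : ∀ v, v ∈ fixSub ρ (X γ) → v ∈ fixSub ρ (gS X I') → v ∈ fixSub ρ (gS X I) := by
      intro v h1 h2
      refine mem_fixSub_of_le_biSup ρ (s := I) (X := X) le_rfl fun i hi g hg => ?_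
      by_cases e : i = γ
      · subst e; exact h1 g hg
      · exact h2 g (le_gS X (⟨hi, e⟩ : i ∈ I') hg)
    let R : V → V := fun v => pr ρ (gS X I') v - pr ρ (gS X I) v
    have Rfix : ∀ β ∈ borelSet Φ f, ∀ v, v ∈ fixSub ρ (X β) → R v ∈ fixSub ρ (X β) :=
      fun β hβ v hv => Submodule.sub_mem _ (pr_mem_fixSub ρ hnrm' (hXB β hβ) hv)
        (pr_mem_fixSub ρ hnrm (hXB β hβ) hv)
    have R0 : ∀ B', γ ∈ B'.1 → R (w B') = 0 := by
      intro B' hB'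
      have h1 : pr ρ (gS X I') (w B') ∈ fixSub ρ (gS X I) :=
        fixI _ (pr_mem_fixSub ρ hnrm' (hXB γ hγB) (hw B' γ hγB hB')) (pr_mem ρ _ _)
      have h2 := pr_eq_self ρ h1
      rw [pr_pr_of_le ρ hle] at h2
      simp only [R, h2, sub_self]
    have Rsum : R (∑ B', w B') = ∑ B', R (w B') := by
      simp only [R, map_sum, Finset.sum_sub_distrib]
    let F := Finset.univ.filter fun B' : {B // IsBorelSet Φ B} => γ ∉ B'.1
    have hFcard : (F.card : ℝ) = Fintype.card {B // IsBorelSet Φ B} / 2 := by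
      have := borel_card (Φ := Φ) hγB.1
      rw [← this]
      push_cast
      simp only [F]
      ring
    have hFsum : ∑ B', R (w B') = ∑ B' ∈ F, R (w B') := by
      refine (Finset.sum_filter_of_ne fun B' _ h => ?_).symm
      exact fun h' => h (R0 B' h')
    have hFsum2 : ∑ B', ‖R (w B')‖ ^ 2 = ∑ B' ∈ F, ‖R (w B')‖ ^ 2 := by
      refine (Finset.sum_filter_of_ne fun B' _ h => ?_).symm
      exact fun h' => h (by rw [R0 B' h']; simp)
    have st : ∀ v, ‖v - pr ρ (gS X I) v‖ ^ 2 = ‖v - pr ρ (gS X I') v‖ ^ 2 + ‖R v‖ ^ 2 :=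
      fun v => pr_step ρ hle v
    rw [st (∑ B', w B'), Finset.sum_congr rfl fun B' _ => st (w B'), Finset.sum_add_distrib, Rsum,
      hFsum, hFsum2]
    rw [← hFcard] at ih' ⊢
    by_cases hγC : γ ∈ borelCore Φ f
    · have hIC := hcore hγC
      rw [Set.inter_eq_left.2 hIC, Finset.sum_congr rfl fun B' _ => st (w B'),
        Finset.sum_add_distrib, hFsum2]
      rw [Set.inter_eq_left.2 (Set.sdiff_subset.trans hIC : I' ⊆ _)] at ih'
      have hFne : F.Nonempty := by
        obtain ⟨f', hf', e⟩ := borel_compl ⟨f, hf, rfl⟩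
        exact ⟨⟨Φ \ borelSet Φ f, f', hf', e⟩, by simp [F, hγB]⟩
      have key := cs_improved F hFne (fun B' => R (w B')) (2 * CN) ?_
      · nlinarith
      · intro s D hD hs hd
        have hc0 : ((F.card : ℝ) : ℂ) ≠ 0 := by
          exact_mod_cast hFne.card_pos.ne'
        have hsc : s = ((F.card : ℝ) : ℂ)⁻¹ • ∑ B' ∈ F, R (w B') := by
          rw [← hs, ← Complex.coe_smul, smul_smul, inv_mul_cancel₀ hc0, one_smul]
        have hsI' : s ∈ fixSub ρ (gS X I') := by
          rw [hsc]
          refine Submodule.smul_mem _ _ (Submodule.sum_mem _ fun B' _ => ?_)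
          exact Submodule.sub_mem _ (pr_mem ρ _ _) (fixSub_anti ρ hle (pr_mem ρ _ _))
        have hsP : pr ρ (gS X I) s = 0 := by
          rw [hsc, map_smul, map_sum, Finset.sum_eq_zero, smul_zero]
          intro B' _
          simp only [R]
          rw [map_sub, pr_pr_of_le ρ hle, pr_pr_of_le ρ le_rfl, sub_self]
        have hS : {β ∈ borelSet Φ f | ¬ ∃ c : ℝ, β = c • γ} ⊆ borelSet Φ f := fun x hx => hx.1
        have hinv : ∀ β ∈ {β ∈ borelSet Φ f | ¬ ∃ c : ℝ, β = c • γ}, ∀ x ∈ X β,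
            ‖ρ x s - s‖ ≤ 2 * D := by
          rintro β ⟨hβ, hβγ⟩ x hx
          obtain ⟨B', h1, h2⟩ := exists_borel_sep hΦ hβ.1 hγB.1 hβγ
          have h3 := Rfix β hβ (w B') (hw B' β hβ h1) x hx
          have h4 := hd B' (by simp [F, h2])
          have h5 : ρ x s - s = (R (w B') - s) - ρ x (R (w B') - s) := by
            rw [map_sub, h3]; abel
          rw [h5]
          refine (norm_sub_le _ _).trans ?_
          rw [(ρ x).norm_map]
          linarith
        have h6 := hnil G X hX V ρ f _ hS s (2 * D) (by linarith) hinv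
        have h7 : ‖s - pr ρ (X γ) s‖ ≤ CN * (2 * D) :=
          hull_lemma ρ (X γ) s _ fun g hg => h6 g (hst f hf γ hγC hg)
        have h8 : pr ρ (X γ) s ∈ fixSub ρ (gS X I) := by
          refine fixI _ (pr_mem ρ _ _) ((pr_eq_self_iff ρ).1 ?_)
          rw [← pr_comm ρ hnrm' (hXB γ hγB), pr_eq_self ρ hsI']
        have h9 := pr_eq_self ρ h8
        rw [pr_pr_of_le ρ (le_gS X hγ), hsP] at h9
        rw [← h9, sub_zero] at h7
        linarith
    · have : I' ∩ borelCore Φ f = I ∩ borelCore Φ f := by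
        ext x
        constructor
        · exact fun h => ⟨h.1.1, h.2⟩
        · exact fun h => ⟨⟨h.1, fun e => hγC (e ▸ h.2)⟩, h.2⟩
      rw [this] at ih'
      have key := cs_fin F (fun B' => R (w B'))
      nlinarith

theorem vertex_lemma {Φ : Set E} (hΦ : IsRootSystem Φ) [Fintype {B // IsBorelSet Φ B}]
    {CN : ℝ} (hCN : 0 ≤ CN) (hnil : IsNilC.{u1, v1} Φ CN) {X : E → Subgroup G}
    (hX : GradingCond Φ X) (hst : IsStrong Φ X) {f : E →ₗ[ℝ] ℝ} (hf : IsRegularFunc Φ f)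
    (w : {B // IsBorelSet Φ B} → V)
    (hw : ∀ B', ∀ β ∈ borelSet Φ f, β ∈ B'.1 → ∀ x ∈ X β, ρ x (w B') = w B') :
    ‖∑ B', w B' - pr ρ (gS X (borelSet Φ f)) (∑ B', w B')‖ ^ 2 ≤
      (Fintype.card {B // IsBorelSet Φ B} / 2 : ℝ) *
      (∑ B', ‖w B' - pr ρ (gS X (borelSet Φ f)) (w B')‖ ^ 2 -
      1 / (1 + (Fintype.card {B // IsBorelSet Φ B} / 2 : ℝ) * (2 * CN) ^ 2) *
        ∑ B', ‖w B' - pr ρ (gS X (borelCore Φ f)) (w B')‖ ^ 2) := by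
  have hB : IsIdl Φ f (borelSet Φ f) := by
    refine ⟨subset_rfl, ?_⟩
    intro α hα β hβ γ hγ a b ha hb e
    refine ⟨hγ, ?_⟩
    have h1 := hα.2
    have h2 := hβ.2
    rw [e, map_add, map_smul, map_smul, smul_eq_mul, smul_eq_mul]; nlinarith
  have h := vertex_aux ρ hΦ hCN hnil hX hst hf w hw _ _ hB rfl
  rwa [Set.inter_eq_right.2 (core_idl hΦ f).1] at h

end
end VertexPart

section SpectralPart
set_option linter.unusedSectionVars false

universe u1 v1

lemma spectral_gap {U : Type*} [NormedAddCommGroup U] [InnerProductSpace ℂ U] [CompleteSpace U]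
    (T : U →ₗ[ℂ] U) (hT : T.IsSymmetric) (c : ℝ) (hc : 0 < c)
    (hpos : ∀ u, 0 ≤ (inner ℂ (T u) u).re) (h : ∀ u, c * (inner ℂ (T u) u).re ≤ ‖T u‖ ^ 2)
    (hinj : ∀ u, T u = 0 → u = 0) (u : U) : c * ‖u‖ ^ 2 ≤ (inner ℂ (T u) u).re := by
  have hcont : Continuous T := hT.continuous
  have hclosed : IsClosed {u : U | c * ‖u‖ ^ 2 ≤ (inner ℂ (T u) u).re} := by
    refine isClosed_le (by fun_prop) (Complex.continuous_re.comp (hcont.inner continuous_id))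
  have hrange : ∀ x, c * ‖T x‖ ^ 2 ≤ (inner ℂ (T (T x)) (T x)).re := by
    intro x
    have h1 := hpos ((c : ℂ) • x - T x)
    have h2 := h x
    have e1 : (inner ℂ (T x) (T x)).re = ‖T x‖ ^ 2 := by
      rw [inner_self_eq_norm_sq_to_K]
      have : ((‖T x‖ : ℝ) : ℂ) ^ 2 = ((‖T x‖ ^ 2 : ℝ) : ℂ) := by push_cast; ring
      exact congrArg Complex.re this
    have e2 : inner ℂ (T (T x)) x = inner ℂ (T x) (T x) := hT _ _
    have e3 : (inner ℂ (T ((c : ℂ) • x - T x)) ((c : ℂ) • x - T x)).re =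
        c ^ 2 * (inner ℂ (T x) x).re - 2 * c * ‖T x‖ ^ 2 + (inner ℂ (T (T x)) (T x)).re := by
      rw [map_sub, map_smul, inner_sub_left, inner_sub_right, inner_sub_right, inner_smul_left,
        inner_smul_left, inner_smul_right, inner_smul_right, e2, Complex.conj_ofReal]
      simp only [Complex.sub_re, Complex.re_ofReal_mul, e1]
      ring
    rw [e3] at h1
    nlinarith
  have hdense : (LinearMap.range T).topologicalClosure = ⊤ := by
    rw [Submodule.topologicalClosure_eq_top_iff, eq_bot_iff]
    intro y hy
    refine hinj y ?_
    have := (Submodule.mem_orthogonal _ _).1 hy (T (T y)) ⟨T y, rfl⟩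
    rw [hT] at this
    exact inner_self_eq_zero.1 this
  have hu : u ∈ closure (LinearMap.range T : Set U) := by
    rw [← Submodule.topologicalClosure_coe, hdense]; trivial
  exact (closure_minimal (by rintro _ ⟨x, rfl⟩; exact hrange x) hclosed) hu

variable {G : Type u1} [Group G] {V : Type v1} [NormedAddCommGroup V] [InnerProductSpace ℂ V]
  [CompleteSpace V] (ρ : G →* (V ≃ₗᵢ[ℂ] V))

instance fixSub_complete (N : Subgroup G) : CompleteSpace (fixSub ρ N) :=
  (fixSub_isClosed ρ N).completeSpace_coe

variable {ι : Type*} [Fintype ι]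

/-- The projected Laplacian on the complete graph. -/
noncomputable def lapT (H : ι → Subgroup G) :
    PiLp 2 (fun i => fixSub ρ (H i)) →ₗ[ℂ] PiLp 2 (fun i => fixSub ρ (H i)) where
  toFun u := WithLp.toLp 2 fun i => (Fintype.card ι : ℂ) • u i -
    ⟨pr ρ (H i) (∑ j, (u j : V)), pr_mem ρ _ _⟩
  map_add' u v := by
    ext i
    simp [Finset.sum_add_distrib]
    abel
  map_smul' c u := by
    ext i
    simp [← Finset.smul_sum, smul_sub, smul_comm c]

lemma lapT_apply (H : ι → Subgroup G) (u : PiLp 2 (fun i => fixSub ρ (H i))) (i : ι) :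
    ((lapT ρ H u i : fixSub ρ (H i)) : V) =
      (Fintype.card ι : ℂ) • (u i : V) - pr ρ (H i) (∑ j, (u j : V)) := rfl

lemma lapT_inner (H : ι → Subgroup G) (u v : PiLp 2 (fun i => fixSub ρ (H i))) :
    inner ℂ (lapT ρ H u) v = (Fintype.card ι : ℂ) * ∑ i, inner ℂ (u i : V) (v i : V) -
      inner ℂ (∑ j, (u j : V)) (∑ j, (v j : V)) := by
  rw [PiLp.inner_apply]
  have : ∀ i, inner ℂ (lapT ρ H u i) (v i) = (Fintype.card ι : ℂ) * inner ℂ (u i : V) (v i : V) -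
      inner ℂ (∑ j, (u j : V)) (v i : V) := by
    intro i
    rw [Submodule.coe_inner, lapT_apply, inner_sub_left, inner_smul_left, pr_symm,
      pr_eq_self ρ (v i).2, map_natCast]
  rw [Finset.sum_congr rfl fun i _ => this i, Finset.sum_sub_distrib, ← Finset.mul_sum, inner_sum]

lemma re_inner_self (v : V) : (inner ℂ v v).re = ‖v‖ ^ 2 := by
  rw [inner_self_eq_norm_sq_to_K]
  have : ((‖v‖ : ℝ) : ℂ) ^ 2 = ((‖v‖ ^ 2 : ℝ) : ℂ) := by push_cast; ring
  exact congrArg Complex.re this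

lemma lapT_quad (H : ι → Subgroup G) (u : PiLp 2 (fun i => fixSub ρ (H i))) :
    (inner ℂ (lapT ρ H u) u).re = (Fintype.card ι : ℝ) * ∑ i, ‖(u i : V)‖ ^ 2 -
      ‖∑ j, (u j : V)‖ ^ 2 := by
  rw [lapT_inner, Complex.sub_re, re_inner_self]
  have : (Fintype.card ι : ℂ) = ((Fintype.card ι : ℝ) : ℂ) := by push_cast; rfl
  rw [this, Complex.re_ofReal_mul, Complex.re_sum, Finset.sum_congr rfl fun i _ => re_inner_self _]

lemma pi_spectral (H : ι → Subgroup G) (c : ℝ) (hc : 0 < c)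
    (hkey : ∀ u : ι → V, (∀ i, u i ∈ fixSub ρ (H i)) →
      c * (Fintype.card ι * ∑ i, ‖u i‖ ^ 2 - ‖∑ i, u i‖ ^ 2) ≤
        ∑ i, ‖(Fintype.card ι : ℂ) • u i - pr ρ (H i) (∑ j, u j)‖ ^ 2)
    (hinj : ∀ u : ι → V, (∀ i, u i ∈ fixSub ρ (H i)) →
      (Fintype.card ι * ∑ i, ‖u i‖ ^ 2 - ‖∑ i, u i‖ ^ 2 = 0) → ∀ i, u i = 0)
    (u : ι → V) (hu : ∀ i, u i ∈ fixSub ρ (H i)) :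
    c * ∑ i, ‖u i‖ ^ 2 ≤ Fintype.card ι * ∑ i, ‖u i‖ ^ 2 - ‖∑ i, u i‖ ^ 2 := by
  have hsq : ∀ u : PiLp 2 (fun i => fixSub ρ (H i)), ‖u‖ ^ 2 = ∑ i, ‖(u i : V)‖ ^ 2 := by
    intro u
    rw [PiLp.norm_sq_eq_of_L2]
    rfl
  have h := spectral_gap (lapT ρ H) ?_ c hc ?_ ?_ ?_ (WithLp.toLp 2 fun i => ⟨u i, hu i⟩)
  · rw [lapT_quad, hsq] at h
    exact h
  · intro u v
    rw [lapT_inner, ← inner_conj_symm u, lapT_inner, map_sub, map_mul, map_natCast, map_sum]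
    simp only [inner_conj_symm]
  · intro u
    rw [lapT_quad]
    have := cs_fin Finset.univ (fun i => (u i : V))
    rw [Finset.card_univ] at this
    linarith
  · intro u
    rw [lapT_quad, hsq]
    exact hkey (fun i => u i) fun i => (u i).2
  · intro u h0
    have h1 := lapT_quad ρ H u
    rw [h0, inner_zero_left, Complex.zero_re] at h1
    ext i
    exact hinj (fun i => u i) (fun i => (u i).2) h1.symm i

lemma edge_sum (u : ι → V) : ∑ i, ∑ j, ‖u i - u j‖ ^ 2 =
    2 * (Fintype.card ι * ∑ i, ‖u i‖ ^ 2 - ‖∑ i, u i‖ ^ 2) := by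
  have h1 : ∀ i j, ‖u i - u j‖ ^ 2 = ‖u i‖ ^ 2 - 2 * (inner ℂ (u i) (u j)).re + ‖u j‖ ^ 2 :=
    fun i j => norm_sub_sq (𝕜 := ℂ) _ _
  simp only [h1, Finset.sum_add_distrib, Finset.sum_sub_distrib, ← Finset.mul_sum,
    Finset.sum_const, Finset.card_univ, nsmul_eq_mul]
  rw [← re_inner_self, sum_inner, Complex.re_sum]
  simp only [inner_sum, Complex.re_sum]
  ring

lemma lap_sum (u : ι → V) : ∑ i, ‖∑ j, (u i - u j)‖ ^ 2 =
    Fintype.card ι * (Fintype.card ι * ∑ i, ‖u i‖ ^ 2 - ‖∑ i, u i‖ ^ 2) := by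
  set S := ∑ j, u j with hS
  set N : ℝ := (Fintype.card ι : ℝ) with hN
  have h0 : ∀ i, ∑ j, (u i - u j) = (N : ℂ) • u i - S := by
    intro i
    rw [Finset.sum_sub_distrib, Finset.sum_const, Finset.card_univ, ← hS, hN]
    simp [Nat.cast_smul_eq_nsmul]
  have h1 : ∀ i, ‖(N : ℂ) • u i - S‖ ^ 2 = N ^ 2 * ‖u i‖ ^ 2 - 2 * N * (inner ℂ (u i) S).re + ‖S‖ ^ 2 := by
    intro i
    have := norm_sub_sq (𝕜 := ℂ) ((N : ℂ) • u i) S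
    rw [this, inner_smul_left, norm_smul, mul_pow, Complex.conj_ofReal, Complex.norm_real,
      Real.norm_eq_abs, sq_abs]
    have e : RCLike.re ((N : ℂ) * inner ℂ (u i) S) = N * (inner ℂ (u i) S).re :=
      Complex.re_ofReal_mul _ _
    rw [e]
    ring
  simp only [h0, h1, Finset.sum_add_distrib, Finset.sum_sub_distrib, ← Finset.mul_sum,
    Finset.sum_const, Finset.card_univ, nsmul_eq_mul]
  rw [← Complex.re_sum, ← sum_inner, ← hS, re_inner_self]
  ring

end SpectralPart

section MainPart
set_option linter.unusedSectionVars false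

universe u1 v1

variable {E : Type*} [AddCommGroup E] [Module ℝ E]
variable {G : Type u1} [Group G] {V : Type v1} [NormedAddCommGroup V] [InnerProductSpace ℂ V]
  [CompleteSpace V] (ρ : G →* (V ≃ₗᵢ[ℂ] V))

/-- Energy estimate: the local energy bounds the global energy. -/
lemma energy_bound {Φ : Set E} [Fintype {B // IsBorelSet Φ B}]
    (hcore : ∀ α ∈ Φ, ∃ f, IsRegularFunc Φ f ∧ α ∈ borelCore Φ f)
    (fn : {B // IsBorelSet Φ B} → (E →ₗ[ℝ] ℝ)) (hfn : ∀ B, B.1 = borelSet Φ (fn B))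
    (hcore' : ∀ α ∈ Φ, ∃ B : {B // IsBorelSet Φ B}, α ∈ borelCore Φ (fn B))
    {CN : ℝ} (hCN : 0 ≤ CN) (hnil : IsNilC.{u1, v1} Φ CN) {X : E → Subgroup G}
    (hX : GradingCond Φ X) {ε : ℝ} (hε : 0 < ε)
    (u : {B // IsBorelSet Φ B} → V) (hu : ∀ B, u B ∈ fixSub ρ (gS X B.1))
    (Y : ℝ) (hY : 0 ≤ Y) (h1 : ∀ B B', ‖pr ρ (gS X B.1) (u B - u B')‖ ^ 2 ≤ Y)
    (h2 : ∀ B B', ε * ‖(u B - u B') - pr ρ (gS X (borelCore Φ (fn B))) (u B - u B')‖ ^ 2 ≤ Y) :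
    ∀ B B', ‖u B - u B'‖ ^ 2 ≤ (1 + 4 * CN ^ 2 / ε) * Y := by
  set d : ℝ := Real.sqrt (Y / ε) with hd
  have hd2 : d ^ 2 = Y / ε := Real.sq_sqrt (div_nonneg hY hε.le)
  have hd0 : 0 ≤ d := Real.sqrt_nonneg _
  have key : ∀ B', ∀ α ∈ Φ, ∀ x ∈ X α, ‖ρ x (u B') - u B'‖ ≤ 2 * d := by
    intro B' α hα x hx
    obtain ⟨A, hA⟩ := hcore' α hα
    have h3 : ‖(u A - u B') - pr ρ (gS X (borelCore Φ (fn A))) (u A - u B')‖ ≤ d := by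
      refine Real.le_sqrt_of_sq_le ?_
      rw [le_div_iff₀ hε, mul_comm]
      exact h2 A B'
    have h4 := almost_of_close ρ _ _ _ h3 x (le_gS X hA hx)
    have hαA : α ∈ A.1 := by rw [hfn A]; exact hA.1
    have h5 : ρ x (u A) = u A := hu A x (le_gS X hαA hx)
    have h6 : ρ x (u A - u B') - (u A - u B') = - (ρ x (u B') - u B') := by
      rw [map_sub, h5]; abel
    rwa [h6, norm_neg] at h4
  intro B B'
  have hBΦ : ∀ x ∈ B.1, x ∈ Φ := fun x hx => by rw [hfn B] at hx; exact hx.1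
  have h3 := hnil G X hX V ρ (fn B) B.1 (hfn B).le (u B') (2 * d) (by linarith)
    (fun β hβ x hx => key B' β (hBΦ β hβ) x hx)
  have h4 := hull_lemma ρ _ _ _ h3
  have h5 : (u B - u B') - pr ρ (gS X B.1) (u B - u B') = - (u B' - pr ρ (gS X B.1) (u B')) := by
    rw [map_sub, pr_eq_self ρ (hu B)]; abel
  rw [pr_pyth ρ (gS X B.1) (u B - u B'), h5, norm_neg]
  have h6 : ‖u B' - pr ρ (gS X B.1) (u B')‖ ^ 2 ≤ 4 * CN ^ 2 / ε * Y := by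
    refine (pow_le_pow_left₀ (norm_nonneg _) h4 2).trans (le_of_eq ?_)
    have : (CN * (2 * d)) ^ 2 = 4 * CN ^ 2 * d ^ 2 := by ring
    rw [this, hd2]
    ring
  have := h1 B B'
  linarith

lemma gap {Φ : Set E} (hΦ : IsRootSystem Φ) [Fintype {B // IsBorelSet Φ B}]
    [Nonempty {B // IsBorelSet Φ B}]
    (hcore : ∀ α ∈ Φ, ∃ f, IsRegularFunc Φ f ∧ α ∈ borelCore Φ f)
    {CN : ℝ} (hCN : 0 ≤ CN) (hnil : IsNilC.{u1, v1} Φ CN) {X : E → Subgroup G}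
    (hX : IsGrading Φ X) (hst : IsStrong Φ X) (hinv : ∀ v : V, (∀ g : G, ρ g v = v) → v = 0)
    {N ε c : ℝ} (hN : N = (Fintype.card {B // IsBorelSet Φ B} : ℝ))
    (hε : ε = 1 / (1 + N / 2 * (2 * CN) ^ 2)) (hc : c = 1 / (N * (1 + 4 * CN ^ 2 / ε)))
    (u : {B // IsBorelSet Φ B} → V) (hu : ∀ B, u B ∈ fixSub ρ (gS X B.1)) :
    c * ∑ B, ‖u B‖ ^ 2 ≤ N * ∑ B, ‖u B‖ ^ 2 - ‖∑ B, u B‖ ^ 2 := by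
  classical
  have hNpos : 0 < N := by rw [hN]; exact_mod_cast Fintype.card_pos
  have hεpos : 0 < ε := by rw [hε]; positivity
  have hcpos : 0 < c := by rw [hc]; positivity
  choose fn hfreg hfn using fun B : {B // IsBorelSet Φ B} => B.2
  have core_eq : ∀ f g : E →ₗ[ℝ] ℝ, borelSet Φ f = borelSet Φ g → borelCore Φ f = borelCore Φ g := by
    intro f g h
    unfold borelCore borelBoundary
    rw [h]
  have hcore' : ∀ α ∈ Φ, ∃ B : {B // IsBorelSet Φ B}, α ∈ borelCore Φ (fn B) := by
    intro α hα
    obtain ⟨f, hf, h⟩ := hcore α hα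
    refine ⟨⟨borelSet Φ f, f, hf, rfl⟩, ?_⟩
    rw [← core_eq f _ (hfn ⟨borelSet Φ f, f, hf, rfl⟩)]
    exact h
  subst hN
  refine pi_spectral ρ (fun B : {B // IsBorelSet Φ B} => gS X B.1) c hcpos ?_ ?_ u hu
  · intro u hu
    set N : ℝ := (Fintype.card {B // IsBorelSet Φ B} : ℝ) with hN
    set A : ℝ := N * ∑ i, ‖u i‖ ^ 2 - ‖∑ i, u i‖ ^ 2 with hA
    have hE := edge_sum u
    have hL := lap_sum u
    rw [← hN, ← hA] at hE hL
    let y : {B // IsBorelSet Φ B} → {B // IsBorelSet Φ B} → ℝ := fun B B' =>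
      ‖pr ρ (gS X B.1) (u B - u B')‖ ^ 2 +
        ε * ‖(u B - u B') - pr ρ (gS X (borelCore Φ (fn B))) (u B - u B')‖ ^ 2
    have hy0 : ∀ B B', 0 ≤ y B B' := fun B B' => by positivity
    set Y : ℝ := ∑ B, ∑ B', y B B' with hYdef
    have hyY : ∀ B B', y B B' ≤ Y := fun B B' =>
      (Finset.single_le_sum (f := fun B' => y B B') (fun B' _ => hy0 B B') (Finset.mem_univ B')).trans
      (Finset.single_le_sum (f := fun B => ∑ B', y B B')
        (fun B _ => Finset.sum_nonneg fun B' _ => hy0 B B') (Finset.mem_univ B))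
    have hY0 : 0 ≤ Y := Finset.sum_nonneg fun B _ => Finset.sum_nonneg fun B' _ => hy0 B B'
    have hb := energy_bound ρ hcore fn hfn hcore' hCN hnil hX.1 hεpos u hu Y hY0
      (fun B B' => by
        have h1 := hyY B B'
        have h2 : 0 ≤ ε * ‖(u B - u B') - pr ρ (gS X (borelCore Φ (fn B))) (u B - u B')‖ ^ 2 := by
          positivity
        simp only [y] at h1
        linarith)
      (fun B B' => by
        have h1 := hyY B B'
        have h2 : 0 ≤ ‖pr ρ (gS X B.1) (u B - u B')‖ ^ 2 := by positivity
        simp only [y] at h1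
        linarith)
    have hEY : 2 * A ≤ N ^ 2 * ((1 + 4 * CN ^ 2 / ε) * Y) := by
      rw [← hE]
      refine (Finset.sum_le_sum fun B _ => Finset.sum_le_sum fun B' _ => hb B B').trans
        (le_of_eq ?_)
      simp only [Finset.sum_const, Finset.card_univ, nsmul_eq_mul]
      rw [← hN]; ring
    -- the vertex inequality, at each vertex
    have hvert : ∀ B, ‖∑ B', (u B - u B')‖ ^ 2 - N / 2 * ∑ B', ‖u B - u B'‖ ^ 2 +
        N / 2 * ∑ B', y B B' ≤ ‖(Fintype.card {B // IsBorelSet Φ B} : ℂ) • u B -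
          pr ρ (gS X B.1) (∑ j, u j)‖ ^ 2 := by
      intro B
      have hv := vertex_lemma ρ hΦ hCN hnil hX.1 hst (hfreg B) (fun B' => u B - u B') (by
        intro B' β hβ hβ' x hx
        rw [← hfn B] at hβ
        have e1 : ρ x (u B) = u B := hu B x (le_gS X hβ hx)
        have e2 : ρ x (u B') = u B' := hu B' x (le_gS X hβ' hx)
        simp only [map_sub, e1, e2])
      rw [← hN, ← hfn B, ← hε] at hv
      have e1 : pr ρ (gS X B.1) (∑ B', (u B - u B')) =
          (Fintype.card {B // IsBorelSet Φ B} : ℂ) • u B - pr ρ (gS X B.1) (∑ j, u j) := by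
        rw [Finset.sum_sub_distrib, Finset.sum_const, Finset.card_univ, map_sub, map_nsmul,
          pr_eq_self ρ (hu B), Nat.cast_smul_eq_nsmul]
      have e2 := pr_pyth ρ (gS X B.1) (∑ B', (u B - u B'))
      rw [e1] at e2
      rw [e1] at hv
      have e3 : ∑ B', ‖u B - u B'‖ ^ 2 = ∑ B', ‖pr ρ (gS X B.1) (u B - u B')‖ ^ 2 +
          ∑ B', ‖(u B - u B') - pr ρ (gS X B.1) (u B - u B')‖ ^ 2 := by
        rw [← Finset.sum_add_distrib]
        exact Finset.sum_congr rfl fun B' _ => pr_pyth ρ _ _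
      have e4 : ∑ B', y B B' = ∑ B', ‖pr ρ (gS X B.1) (u B - u B')‖ ^ 2 +
          ε * ∑ B', ‖(u B - u B') - pr ρ (gS X (borelCore Φ (fn B))) (u B - u B')‖ ^ 2 := by
        rw [Finset.mul_sum, ← Finset.sum_add_distrib]
      rw [e3, e4]
      linarith
    have hsum := Finset.sum_le_sum fun B (_ : B ∈ Finset.univ) => hvert B
    rw [Finset.sum_add_distrib, Finset.sum_sub_distrib, ← Finset.mul_sum, ← Finset.mul_sum, hL, hE,
      ← hYdef] at hsum
    refine le_trans ?_ hsum
    have : c * A ≤ N / 2 * Y := by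
      rw [hc, one_div, inv_mul_le_iff₀ (by positivity)]
      nlinarith
    linarith
  · intro u hu h0
    have hE := edge_sum u
    rw [h0, mul_zero] at hE
    have heq : ∀ B B', u B = u B' := by
      intro B B'
      rw [Finset.sum_eq_zero_iff_of_nonneg
        (fun B _ => Finset.sum_nonneg fun B' _ => sq_nonneg _)] at hE
      have h1 := hE B (Finset.mem_univ B)
      rw [Finset.sum_eq_zero_iff_of_nonneg (fun B' _ => sq_nonneg _)] at h1
      have h2 := h1 B' (Finset.mem_univ B')
      rw [sq_eq_zero_iff, norm_eq_zero, sub_eq_zero] at h2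
      exact h2
    intro B
    refine hinv _ ?_
    have : u B ∈ fixSub ρ (⊤ : Subgroup G) := by
      refine mem_fixSub_of_le_biSup ρ (s := Φ) (X := X) hX.2.ge fun α hα g hg => ?_
      obtain ⟨B', hB'⟩ := hcore' α hα
      rw [heq B B']
      refine hu B' g (le_gS X ?_ hg)
      rw [hfn B']; exact hB'.1
    exact fun g => this g (Subgroup.mem_top g)

end MainPart

/-- Theorem 5.1: if `Φ` is a regular root system, there is a constant `κ_Φ > 0`,
depending only on `Φ`, such that for every group `G` with a strong `Φ`-grading
`{X_α}`, the union of the root subgroups is a Kazhdan subset of `G` with Kazhdan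
constant at least `κ_Φ`. -/
theorem statement8 {E : Type*} [AddCommGroup E] [Module ℝ E] [FiniteDimensional ℝ E]
    (Φ : Set E) (hΦ : IsRootSystem Φ) (hreg : IsRegularRS Φ) :
    ∃ κ : ℝ, 0 < κ ∧
      ∀ (G : Type*) [Group G], ∀ X : E → Subgroup G,
        IsGrading Φ X → IsStrong Φ X →
        ∀ (V : Type*) [NormedAddCommGroup V] [InnerProductSpace ℂ V] [CompleteSpace V],
          ∀ ρ : G →* (V ≃ₗᵢ[ℂ] V),
          (∀ v : V, (∀ g : G, ρ g v = v) → v = 0) →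
          ∀ v : V, ‖v‖ = 1 → ∃ α ∈ Φ, ∃ x ∈ X α, κ ≤ ‖ρ x v - v‖ := by
  classical
  rcases Φ.eq_empty_or_nonempty with hemp | hne
  · refine ⟨1, one_pos, ?_⟩
    intro G _ X hX _ V _ _ _ ρ hinv v hv
    exfalso
    have : v = 0 := by
      refine hinv v fun g => ?_
      have h : g ∈ (⊤ : Subgroup G) := Subgroup.mem_top g
      rw [← hX.2, hemp] at h
      simp only [Set.mem_empty_iff_false, iSup_false, iSup_bot, Subgroup.mem_bot] at h
      rw [h, rho_one]
    rw [this, norm_zero] at hv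
    exact zero_ne_one hv
  haveI : Fintype {B // IsBorelSet Φ B} := (borel_finite hΦ.finite).fintype
  haveI : Nonempty {B // IsBorelSet Φ B} := by
    obtain ⟨θ, hθ⟩ := exists_reg hΦ
    exact ⟨⟨borelSet Φ θ, θ, hθ, rfl⟩⟩
  obtain ⟨CN, hCN, hnil⟩ := exists_nilC hΦ.finite hne
  obtain ⟨N, hN⟩ : ∃ N : ℝ, N = (Fintype.card {B // IsBorelSet Φ B} : ℝ) := ⟨_, rfl⟩
  obtain ⟨ε, hε⟩ : ∃ ε : ℝ, ε = 1 / (1 + N / 2 * (2 * CN) ^ 2) := ⟨_, rfl⟩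
  obtain ⟨c, hc⟩ : ∃ c : ℝ, c = 1 / (N * (1 + 4 * CN ^ 2 / ε)) := ⟨_, rfl⟩
  have hNpos : 0 < N := by rw [hN]; exact_mod_cast Fintype.card_pos
  have hεpos : 0 < ε := by rw [hε]; positivity
  have hcpos : 0 < c := by rw [hc]; positivity
  set q : ℝ := Real.sqrt (c / (2 * N + c)) with hq
  have hqpos : 0 < q := Real.sqrt_pos.2 (by positivity)
  have hq2 : q ^ 2 = c / (2 * N + c) := Real.sq_sqrt (by positivity)
  refine ⟨q / (CN + 1), by positivity, ?_⟩
  intro G _ X hX hst V _ _ _ ρ hinv v hv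
  by_contra! hcon
  set η : ℝ := CN * (q / (CN + 1)) with hη
  have hη0 : 0 ≤ η := by positivity
  have hηq : η < q := by
    rw [hη, ← mul_div_assoc, div_lt_iff₀ (by positivity)]
    nlinarith
  have hη2 : η ^ 2 * (2 * N + c) < c := by
    have h1 : η ^ 2 < q ^ 2 := pow_lt_pow_left₀ hηq hη0 two_ne_zero
    rw [hq2, lt_div_iff₀ (by positivity)] at h1
    exact h1
  have hclose : ∀ B : {B // IsBorelSet Φ B}, ‖v - pr ρ (gS X B.1) v‖ ≤ η := by
    rintro ⟨B, f, hf, rfl⟩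
    refine hull_lemma ρ _ _ _ ?_
    exact hnil G X hX.1 V ρ f _ subset_rfl v _ (by positivity)
      fun β hβ x hx => (hcon β hβ.1 x hx).le
  let u : {B // IsBorelSet Φ B} → V := fun B => pr ρ (gS X B.1) v
  have hgap := gap ρ hΦ (fun α hα => exists_core hΦ hreg hα) hCN hnil hX hst hinv hN hε hc u
    fun B => pr_mem ρ _ _
  have hE := edge_sum u
  rw [← hN] at hE
  have hE2 : ∑ i, ∑ j, ‖u i - u j‖ ^ 2 ≤ N ^ 2 * (2 * η) ^ 2 := by
    refine (Finset.sum_le_sum fun B _ => Finset.sum_le_sum fun B' _ =>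
      (pow_le_pow_left₀ (norm_nonneg _) (?_ : ‖u B - u B'‖ ≤ 2 * η) 2)).trans (le_of_eq ?_)
    · have e : u B - u B' = (v - u B') - (v - u B) := by abel
      rw [e]
      refine (norm_sub_le _ _).trans ?_
      have := hclose B
      have := hclose B'
      simp only [u]
      linarith
    · simp only [Finset.sum_const, Finset.card_univ, nsmul_eq_mul]
      rw [← hN]; ring
  have hlow : N * (1 - η ^ 2) ≤ ∑ B, ‖u B‖ ^ 2 := by
    have : ∑ _B : {B // IsBorelSet Φ B}, (1 - η ^ 2) ≤ ∑ B, ‖u B‖ ^ 2 := by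
      refine Finset.sum_le_sum fun B _ => ?_
      have h1 := pr_pyth ρ (gS X B.1) v
      have h2 := pow_le_pow_left₀ (norm_nonneg _) (hclose B) 2
      rw [hv] at h1
      simp only [u]
      linarith
    rw [Finset.sum_const, Finset.card_univ, nsmul_eq_mul, ← hN] at this
    exact this
  have h1 : c * (N * (1 - η ^ 2)) ≤ 2 * N ^ 2 * η ^ 2 := by
    have := mul_le_mul_of_nonneg_left hlow hcpos.le
    nlinarith
  have h2 : N * (η ^ 2 * (2 * N + c)) < N * c := mul_lt_mul_of_pos_left hη2 hNpos
  nlinarith
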